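/- Let α ∈ ℝ and R̄ : V → ℝ with α R̄_i ≤ 0 for all i. In the Euclidean background, any two C¹ solutions u_A, u_B : [0,T) → ℝᴺ of the extended modified combinatorial α-Ricci flow du_i/dt = R̄_i − R̃_{α,i}(u) with u_A(0) = u_B(0) coincide on [0,T). Likewise, in the hyperbolic background, any two C¹ solutions taking values in ℝ^{N₀} × (−∞,0)^{N₁} of the extended modified combinatorial α-Ricci flow du_i/dt = R̄_i − R̃_{α,i}(u) with the same initial value coincide. -/

import Mathlib

open Real

/-- A combinatorial triangulation of a connected closed surface on the vertex set
`Fin N`: a nonempty set of triangular faces covering all vertices, such that every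
edge (2-element subset of a face) lies in exactly two faces and the underlying
graph is connected. -/
structure TriSurface (N : ℕ) where
  /-- The set of faces, each a 3-element subset of the vertex set. -/
  F : Finset (Finset (Fin N))
  F_nonempty : F.Nonempty
  card_face : ∀ σ ∈ F, σ.card = 3
  vertex_cover : ∀ v : Fin N, ∃ σ ∈ F, v ∈ σ
  edge_two_faces : ∀ e : Finset (Fin N), e.card = 2 → (∃ σ ∈ F, e ⊆ σ) →
    (F.filter fun σ => e ⊆ σ).card = 2
  connected : (SimpleGraph.fromRel fun i j => ∃ σ ∈ F, i ∈ σ ∧ j ∈ σ).Connected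

namespace TriSurface

variable {N : ℕ}

/-- The edge set: all 2-element subsets of faces. -/
def edges (S : TriSurface N) : Finset (Finset (Fin N)) :=
  S.F.biUnion fun σ => Finset.powersetCard 2 σ

/-- The Euler characteristic `χ = N - |E| + |F|`. -/
def chi (S : TriSurface N) : ℤ :=
  (N : ℤ) - (S.edges.card : ℤ) + (S.F.card : ℤ)

/-- Weights on a triangulated surface: scheme coefficients `ε : V → {0,1}` and symmetric
discrete conformal structure coefficients `η : E → ℝ`, subject to the structure conditions
`ε_s ε_t + η_st > 0` on every edge and `ε_q η_st + η_qs η_qt ≥ 0` in every face. -/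
structure Weights (S : TriSurface N) where
  eps : Fin N → ℝ
  eta : Fin N → Fin N → ℝ
  eps01 : ∀ i, eps i = 0 ∨ eps i = 1
  eta_symm : ∀ i j, eta i j = eta j i
  structCond1 : ∀ i j : Fin N, ({i, j} : Finset (Fin N)) ∈ S.edges →
    eps i * eps j + eta i j > 0
  structCond2 : ∀ i j k : Fin N, ({i, j, k} : Finset (Fin N)) ∈ S.F →
    i ≠ j → i ≠ k → j ≠ k → eps i * eta j k + eta i j * eta i k ≥ 0

variable {S : TriSurface N}

/-! ### Euclidean background -/

/-- Euclidean edge length `l_ij = sqrt(ε_i e^{2u_i} + ε_j e^{2u_j} + 2 η_ij e^{u_i+u_j})`. -/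
noncomputable def lE (W : Weights S) (u : Fin N → ℝ) (i j : Fin N) : ℝ :=
  Real.sqrt (W.eps i * exp (2 * u i) + W.eps j * exp (2 * u j) +
    2 * W.eta i j * exp (u i + u j))

/-- The admissible space `U^E`: discrete conformal factors for which every face satisfies
the strict triangle inequalities. -/
def admissibleE (W : Weights S) (u : Fin N → ℝ) : Prop :=
  ∀ i j k : Fin N, ({i, j, k} : Finset (Fin N)) ∈ S.F →
    lE W u i j + lE W u i k > lE W u j k

/-- The inner angle `θ_i^{jk}` at `i` in the face `{i,j,k}`, by the law of cosines. -/
noncomputable def thetaE (W : Weights S) (u : Fin N → ℝ) (i j k : Fin N) : ℝ :=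
  arccos ((lE W u i j ^ 2 + lE W u i k ^ 2 - lE W u j k ^ 2) /
    (2 * lE W u i j * lE W u i k))

open Classical in
/-- The extended inner angle `θ̃_i^{jk}`: equal to `θ_i^{jk}` when the three strict triangle
inequalities hold in the face, to `π` when the edge opposite to `i` dominates, and to `0`
otherwise. -/
noncomputable def thetaExE (W : Weights S) (u : Fin N → ℝ) (i j k : Fin N) : ℝ :=
  if lE W u i j + lE W u i k > lE W u j k ∧ lE W u i j + lE W u j k > lE W u i k ∧
      lE W u i k + lE W u j k > lE W u i j then thetaE W u i j k
  else if lE W u j k ≥ lE W u i j + lE W u i k then π else 0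

open Classical in
/-- The angle at `i` in a face `σ` containing `i` (the half-sum over the two orderings of
the remaining two vertices; the angle is symmetric in the last two arguments). -/
noncomputable def faceAngleE (W : Weights S) (u : Fin N → ℝ) (i : Fin N)
    (σ : Finset (Fin N)) : ℝ :=
  (1 / 2) * ∑ j ∈ σ.erase i, ∑ k ∈ (σ.erase i).erase j, thetaE W u i j k

open Classical in
/-- The extended angle at `i` in a face `σ` containing `i`. -/
noncomputable def faceAngleExE (W : Weights S) (u : Fin N → ℝ) (i : Fin N)
    (σ : Finset (Fin N)) : ℝ :=
  (1 / 2) * ∑ j ∈ σ.erase i, ∑ k ∈ (σ.erase i).erase j, thetaExE W u i j k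

open Classical in
/-- The classical combinatorial curvature `K_i = 2π − Σ θ_i^{jk}`. -/
noncomputable def KE (W : Weights S) (u : Fin N → ℝ) (i : Fin N) : ℝ :=
  2 * π - ∑ σ ∈ S.F.filter (fun σ => i ∈ σ), faceAngleE W u i σ

open Classical in
/-- The extended combinatorial curvature `K̃_i = 2π − Σ θ̃_i^{jk}`. -/
noncomputable def KExE (W : Weights S) (u : Fin N → ℝ) (i : Fin N) : ℝ :=
  2 * π - ∑ σ ∈ S.F.filter (fun σ => i ∈ σ), faceAngleExE W u i σ

/-- The combinatorial `α`-curvature `R_{α,i} = K_i e^{−α u_i}` (Euclidean background). -/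
noncomputable def RE (W : Weights S) (α : ℝ) (u : Fin N → ℝ) (i : Fin N) : ℝ :=
  KE W u i * exp (-(α * u i))

/-- The extended combinatorial `α`-curvature `R̃_{α,i} = K̃_i e^{−α u_i}` (Euclidean). -/
noncomputable def RExE (W : Weights S) (α : ℝ) (u : Fin N → ℝ) (i : Fin N) : ℝ :=
  KExE W u i * exp (-(α * u i))

/-- The Jacobian `∂K_i/∂u_j` of the curvature map in the Euclidean background. -/
noncomputable def DKE (W : Weights S) (u : Fin N → ℝ) (i j : Fin N) : ℝ :=
  fderiv ℝ (fun v => KE W v i) u (Pi.single j 1)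

/-- The discrete `α`-Laplacian `(Δ_α g)_i = −e^{−α u_i} Σ_j (∂K_i/∂u_j) g_j` (Euclidean). -/
noncomputable def LapE (W : Weights S) (α : ℝ) (u : Fin N → ℝ) (g : Fin N → ℝ)
    (i : Fin N) : ℝ :=
  -exp (-(α * u i)) * ∑ j, DKE W u i j * g j

/-! ### Hyperbolic background -/

/-- The inverse hyperbolic cosine. -/
noncomputable def arcosh (x : ℝ) : ℝ := Real.log (x + Real.sqrt (x ^ 2 - 1))

/-- Hyperbolic edge length
`l_ij = arcosh(sqrt((1+ε_i e^{2f_i})(1+ε_j e^{2f_j})) + η_ij e^{f_i+f_j})`. -/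
noncomputable def lH (W : Weights S) (f : Fin N → ℝ) (i j : Fin N) : ℝ :=
  arcosh (Real.sqrt ((1 + W.eps i * exp (2 * f i)) * (1 + W.eps j * exp (2 * f j))) +
    W.eta i j * exp (f i + f j))

open Classical in
/-- The coordinate change `f ↦ u` at a vertex with scheme coefficient `e`. -/
noncomputable def ucoord (e x : ℝ) : ℝ :=
  if e = 0 then x
  else (1 / 2) * Real.log ((Real.sqrt (1 + exp (2 * x)) - 1) / (Real.sqrt (1 + exp (2 * x)) + 1))

/-- The discrete conformal structure `u` associated to the conformal factor `f`
(hyperbolic background). -/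
noncomputable def uOf (W : Weights S) (f : Fin N → ℝ) (i : Fin N) : ℝ :=
  ucoord (W.eps i) (f i)

/-- The admissible space `U^H` (described in the `f`-coordinates): every face satisfies
the strict triangle inequalities. -/
def admissibleH (W : Weights S) (f : Fin N → ℝ) : Prop :=
  ∀ i j k : Fin N, ({i, j, k} : Finset (Fin N)) ∈ S.F →
    lH W f i j + lH W f i k > lH W f j k

/-- The inner angle `θ_i^{jk}` at `i` in the hyperbolic face `{i,j,k}`, by the hyperbolic
law of cosines. -/
noncomputable def thetaH (W : Weights S) (f : Fin N → ℝ) (i j k : Fin N) : ℝ :=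
  arccos ((Real.cosh (lH W f i j) * Real.cosh (lH W f i k) - Real.cosh (lH W f j k)) /
    (Real.sinh (lH W f i j) * Real.sinh (lH W f i k)))

open Classical in
/-- The extended hyperbolic inner angle `θ̃_i^{jk}`. -/
noncomputable def thetaExH (W : Weights S) (f : Fin N → ℝ) (i j k : Fin N) : ℝ :=
  if lH W f i j + lH W f i k > lH W f j k ∧ lH W f i j + lH W f j k > lH W f i k ∧
      lH W f i k + lH W f j k > lH W f i j then thetaH W f i j k
  else if lH W f j k ≥ lH W f i j + lH W f i k then π else 0

open Classical in
/-- The angle at `i` in a hyperbolic face `σ` containing `i`. -/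
noncomputable def faceAngleH (W : Weights S) (f : Fin N → ℝ) (i : Fin N)
    (σ : Finset (Fin N)) : ℝ :=
  (1 / 2) * ∑ j ∈ σ.erase i, ∑ k ∈ (σ.erase i).erase j, thetaH W f i j k

open Classical in
/-- The extended angle at `i` in a hyperbolic face `σ` containing `i`. -/
noncomputable def faceAngleExH (W : Weights S) (f : Fin N → ℝ) (i : Fin N)
    (σ : Finset (Fin N)) : ℝ :=
  (1 / 2) * ∑ j ∈ σ.erase i, ∑ k ∈ (σ.erase i).erase j, thetaExH W f i j k

open Classical in
/-- The classical combinatorial curvature (hyperbolic background). -/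
noncomputable def KH (W : Weights S) (f : Fin N → ℝ) (i : Fin N) : ℝ :=
  2 * π - ∑ σ ∈ S.F.filter (fun σ => i ∈ σ), faceAngleH W f i σ

open Classical in
/-- The extended combinatorial curvature (hyperbolic background). -/
noncomputable def KExH (W : Weights S) (f : Fin N → ℝ) (i : Fin N) : ℝ :=
  2 * π - ∑ σ ∈ S.F.filter (fun σ => i ∈ σ), faceAngleExH W f i σ

/-- The combinatorial `α`-curvature `R_{α,i} = K_i e^{−α u_i}` (hyperbolic background),
expressed as a function of the conformal factor `f`. -/
noncomputable def RH (W : Weights S) (α : ℝ) (f : Fin N → ℝ) (i : Fin N) : ℝ :=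
  KH W f i * exp (-(α * uOf W f i))

/-- The extended combinatorial `α`-curvature `R̃_{α,i} = K̃_i e^{−α u_i}` (hyperbolic). -/
noncomputable def RExH (W : Weights S) (α : ℝ) (f : Fin N → ℝ) (i : Fin N) : ℝ :=
  KExH W f i * exp (-(α * uOf W f i))

/-- The Jacobian `∂K_i/∂u_j` in the hyperbolic background, computed by the chain rule from
the `f`-coordinates: `(∂K_i/∂f_j) / (du_j/df_j)`. -/
noncomputable def DKH (W : Weights S) (f : Fin N → ℝ) (i j : Fin N) : ℝ :=
  fderiv ℝ (fun g => KH W g i) f (Pi.single j 1) / deriv (ucoord (W.eps j)) (f j)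

/-- The discrete `α`-Laplacian `(Δ_α g)_i = −e^{−α u_i} Σ_j (∂K_i/∂u_j) g_j` (hyperbolic). -/
noncomputable def LapH (W : Weights S) (α : ℝ) (f : Fin N → ℝ) (g : Fin N → ℝ)
    (i : Fin N) : ℝ :=
  -exp (-(α * uOf W f i)) * ∑ j, DKH W f i j * g j

/-- The Euclidean norm on `Fin N → ℝ`. -/
noncomputable def enorm (v : Fin N → ℝ) : ℝ := Real.sqrt (∑ i, v i ^ 2)

end TriSurface

open TriSurface

/-- The data of a discrete conformal structure at one conformal factor: `lam` is `0` in the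
Euclidean and `1` in the hyperbolic background, `e` and `h` are the weights, `x` the radii, and `c` the
hyperbolic cosines of the radii (or `1`). -/
structure ConformalData (ι : Type) where
  lam : ℝ
  e : ι → ℝ
  x : ι → ℝ
  c : ι → ℝ
  h : ι → ι → ℝ

namespace ConformalData

variable {ι : Type} (d : ConformalData ι)

/-- The relations satisfied by the data of a discrete conformal structure. -/
structure Valid : Prop where
  lam01 : d.lam = 0 ∨ d.lam = 1
  e01 : ∀ i, d.e i = 0 ∨ d.e i = 1
  x_pos : ∀ i, 0 < d.x i
  c_pos : ∀ i, 0 < d.c i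
  c_sq : ∀ i, d.c i ^ 2 = 1 + d.lam * d.e i * d.x i ^ 2
  h_symm : ∀ i j, d.h i j = d.h j i

/-- The structure conditions on the weights of a face. -/
structure FaceCond (i j k : ι) : Prop where
  edge_ij : 0 < d.e i * d.e j + d.h i j
  edge_ik : 0 < d.e i * d.e k + d.h i k
  edge_jk : 0 < d.e j * d.e k + d.h j k
  face_i : 0 ≤ d.e i * d.h j k + d.h i j * d.h i k
  face_j : 0 ≤ d.e j * d.h i k + d.h i j * d.h j k
  face_k : 0 ≤ d.e k * d.h i j + d.h i k * d.h j k

/-- Half the squared length of an edge in the Euclidean background, and `cosh l - 1` in the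
hyperbolic background. -/
noncomputable def y (i j : ι) : ℝ :=
  d.lam * (d.c i * d.c j - 1) +
    (1 - d.lam) * ((d.e i * d.x i ^ 2 + d.e j * d.x j ^ 2) / 2) + d.h i j * (d.x i * d.x j)

/-- The squared length of an edge in the Euclidean background, and `sinh l ^ 2` in the hyperbolic
background. -/
noncomputable def z (i j : ι) : ℝ := 2 * d.y i j + d.lam * d.y i j ^ 2

/-- The derivative of `y i j` in the direction of the coordinate at `i`. -/
noncomputable def a (i j : ι) : ℝ :=
  d.e i * d.x i ^ 2 * d.c j + d.h i j * (d.x i * d.x j) * d.c i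

/-- The numerator of the cosine of the angle at `i` in the law of cosines. -/
noncomputable def n (i j k : ι) : ℝ :=
  d.y i j + d.y i k - d.y j k + d.lam * (d.y i j * d.y i k)

/-- The squared sine of the angle at `i`, times the product of the adjacent `z`; it is symmetric in
the three vertices. -/
noncomputable def disc (i j k : ι) : ℝ := d.z i j * d.z i k - d.n i j k ^ 2

/-- The numerator of the height of the edge `{i, j}` in the face `{i, j, k}`. -/
noncomputable def gam (i j k : ι) : ℝ :=
  (d.e i * d.e j - d.h i j ^ 2) * (d.x i * d.x j) ^ 2 * d.c k +
    (d.e j * d.h i k + d.h i j * d.h j k) * (d.x i * d.x j ^ 2 * d.x k) * d.c i +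
    (d.e i * d.h j k + d.h i j * d.h i k) * (d.x i ^ 2 * d.x j * d.x k) * d.c j

/-- The variation of `y i j` in the direction `ξ`. -/
noncomputable def dy (ξ : ι → ℝ) (i j : ι) : ℝ := d.a i j * ξ i + d.a j i * ξ j

/-- The variation of the angle at `i` in the direction `ξ`, times the square root of the
discriminant. -/
noncomputable def r (ξ : ι → ℝ) (i j k : ι) : ℝ :=
  d.dy ξ j k - d.n k i j / d.z i k * d.dy ξ i k - d.n j i k / d.z i j * d.dy ξ i j

/-- The linear form spanning the degenerate quadratic form of the angle variations. -/
noncomputable def ell (ξ : ι → ℝ) (i j k : ι) : ℝ :=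
  ξ i - (d.n k i j / d.z j k) * ξ j - (d.n j i k / d.z j k) * ξ k

/-- A coefficient of the part of the variation of the angle at `i` divisible by the discriminant. -/
noncomputable def bet (i j k : ι) : ℝ :=
  d.a i k / (d.z j k * d.z i k) - (1 + d.lam * d.y j k) * (d.a i j / (d.z j k * d.z i j))

/-- The part divisible by the discriminant of the variation of the angle at `j`, up to multiples of
the variation at `i`. -/
noncomputable def eta (ξ : ι → ℝ) (i j k : ι) : ℝ :=
  d.dy ξ i k / (d.z j k * d.z i k) - (1 + d.lam * d.y j k) * (d.dy ξ i j / (d.z j k * d.z i j))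

/-- The remainder of the quadratic form of the angle variations, divided by the discriminant. -/
noncomputable def rem (ξ : ι → ℝ) (i j k : ι) : ℝ :=
  (d.bet i j k * ξ j + d.bet i k j * ξ k) * d.ell ξ i j k + ξ j * d.eta ξ i j k +
    ξ k * d.eta ξ i k j

/-- The coefficient of the degenerate part of the quadratic form of the angle variations. -/
noncomputable def p (i j k : ι) : ℝ :=
  d.n k i j / d.z i k * d.a i k + d.n j i k / d.z i j * d.a i j

/-- Under the structure conditions, two of the three height numerators at a face cannot both be
nonpositive. -/
theorem weights_dichotomy {e₁ e₂ e₃ h₁₂ h₁₃ h₂₃ k₁ k₂ k₃ : ℝ} (he₁ : e₁ = 0 ∨ e₁ = 1)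
    (he₂ : e₂ = 0 ∨ e₂ = 1) (he₃ : e₃ = 0 ∨ e₃ = 1) (h12 : 0 < e₁ * e₂ + h₁₂)
    (h13 : 0 < e₁ * e₃ + h₁₃) (h23 : 0 < e₂ * e₃ + h₂₃) (hf₁ : 0 ≤ e₁ * h₂₃ + h₁₂ * h₁₃)
    (hf₂ : 0 ≤ e₂ * h₁₃ + h₁₂ * h₂₃) (hf₃ : 0 ≤ e₃ * h₁₂ + h₁₃ * h₂₃)
    (hk₁ : 0 < k₁) (hk₂ : 0 < k₂) (hk₃ : 0 < k₃)
    (hM₃ : (e₁ * e₂ - h₁₂ ^ 2) * k₃ + (e₂ * h₁₃ + h₁₂ * h₂₃) * k₁ +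
      (e₁ * h₂₃ + h₁₂ * h₁₃) * k₂ ≤ 0)
    (hM₂ : (e₁ * e₃ - h₁₃ ^ 2) * k₂ + (e₃ * h₁₂ + h₁₃ * h₂₃) * k₁ +
      (e₁ * h₂₃ + h₁₂ * h₁₃) * k₃ ≤ 0) : False := by
  rcases he₁ with rfl | rfl
  · have p12 : 0 < h₁₂ := by linarith
    have p13 : 0 < h₁₃ := by linarith
    have hle : (e₂ * h₁₃ ^ 2 + e₃ * h₁₂ ^ 2 + 2 * (h₁₂ * h₁₃) * h₂₃) * k₁ ≤ 0 := by
      nlinarith [mul_le_mul_of_nonneg_left hM₃ p13.le, mul_le_mul_of_nonneg_left hM₂ p12.le]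
    have hpos : 0 < e₂ * h₁₃ ^ 2 + e₃ * h₁₂ ^ 2 + 2 * (h₁₂ * h₁₃) * h₂₃ := by
      have h1 := mul_pos (mul_pos p12 p13) h23
      rcases he₂ with rfl | rfl <;> rcases he₃ with rfl | rfl <;>
        nlinarith [sq_nonneg (h₁₂ - h₁₃), sq_nonneg h₁₂, sq_nonneg h₁₃]
    exact absurd hle (not_le.2 (mul_pos hpos hk₁))
  · have q₃ : (h₂₃ + h₁₂ * h₁₃) * k₂ ≤ (h₁₂ ^ 2 - e₂) * k₃ := by
      nlinarith [mul_nonneg hf₂ hk₁.le]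
    have q₂ : (h₂₃ + h₁₂ * h₁₃) * k₃ ≤ (h₁₃ ^ 2 - e₃) * k₂ := by
      nlinarith [mul_nonneg hf₃ hk₁.le]
    have m : 0 ≤ h₂₃ + h₁₂ * h₁₃ := by linarith
    have b₃ : 0 ≤ h₁₂ ^ 2 - e₂ := nonneg_of_mul_nonneg_left ((mul_nonneg m hk₂.le).trans q₃) hk₃
    have b₂ : 0 ≤ h₁₃ ^ 2 - e₃ := nonneg_of_mul_nonneg_left ((mul_nonneg m hk₃.le).trans q₂) hk₂
    have hsq : (h₂₃ + h₁₂ * h₁₃) ^ 2 ≤ (h₁₂ ^ 2 - e₂) * (h₁₃ ^ 2 - e₃) := by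
      have := mul_le_mul q₃ q₂ (mul_nonneg m hk₃.le) (mul_nonneg b₃ hk₃.le)
      refine le_of_mul_le_mul_right (a := k₂ * k₃) ?_ (mul_pos hk₂ hk₃)
      nlinarith
    have p12 : e₂ ≤ h₁₂ := by rcases he₂ with rfl | rfl <;> nlinarith
    have p13 : e₃ ≤ h₁₃ := by rcases he₃ with rfl | rfl <;> nlinarith
    rcases he₂ with rfl | rfl <;> rcases he₃ with rfl | rfl
    · nlinarith [mul_nonneg p12 p13]
    · nlinarith [mul_nonneg p12 (zero_le_one.trans p13)]
    · nlinarith [mul_nonneg (zero_le_one.trans p12) p13]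
    · have h1 : 0 ≤ h₁₂ * h₁₃ - 1 := by nlinarith
      nlinarith [sq_nonneg (h₁₂ - h₁₃)]

variable {d}
variable (hd : d.Valid)
include hd

theorem Valid.y_comm (i j : ι) : d.y i j = d.y j i := by
  unfold y; rw [hd.h_symm i j]; ring

theorem Valid.z_comm (i j : ι) : d.z i j = d.z j i := by
  unfold z; rw [hd.y_comm i j]

omit hd in
variable (d) in
theorem dy_comm (ξ : ι → ℝ) (i j : ι) : d.dy ξ i j = d.dy ξ j i := by
  unfold dy; ring

theorem Valid.n_comm (i j k : ι) : d.n i j k = d.n i k j := by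
  unfold n; rw [hd.y_comm j k]; ring

theorem Valid.faceCond_rotate {i j k : ι} (hf : d.FaceCond i j k) : d.FaceCond j k i where
  edge_ij := hf.edge_jk
  edge_ik := by rw [hd.h_symm j i, mul_comm]; exact hf.edge_ij
  edge_jk := by rw [hd.h_symm k i, mul_comm]; exact hf.edge_ik
  face_i := by rw [hd.h_symm k i, hd.h_symm j i, mul_comm (d.h j k)]; exact hf.face_j
  face_j := by rw [hd.h_symm j i, hd.h_symm k i, mul_comm (d.h j k)]; exact hf.face_k
  face_k := by rw [hd.h_symm j i, hd.h_symm k i]; exact hf.face_i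

theorem Valid.gam_comm (i j k : ι) : d.gam i j k = d.gam j i k := by
  unfold gam; rw [hd.h_symm i j]; ring

theorem Valid.y_pos {i j : ι} (h : 0 < d.e i * d.e j + d.h i j) : 0 < d.y i j := by
  have hxi := hd.x_pos i
  have hxj := hd.x_pos j
  have hci := hd.c_pos i
  have hcj := hd.c_pos j
  have hsi := hd.c_sq i
  have hsj := hd.c_sq j
  have hxx := mul_pos hxi hxj
  unfold y
  rcases hd.lam01 with hl | hl <;> rw [hl] at hsi hsj ⊢ <;>
  rcases hd.e01 i with hi | hi <;> rcases hd.e01 j with hj | hj <;>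
    simp only [hi, hj] at h hsi hsj ⊢
  · nlinarith
  · nlinarith
  · nlinarith
  · nlinarith [sq_nonneg (d.x i - d.x j)]
  · have : d.c i = 1 := by nlinarith
    have : d.c j = 1 := by nlinarith
    simp_all
  · have : d.c i = 1 := by nlinarith
    have : 1 ≤ d.c j := by nlinarith
    have := mul_pos h hxx
    simp_all only [mul_zero, zero_mul, mul_one, one_mul]; linarith
  · have : d.c j = 1 := by nlinarith
    have : 1 ≤ d.c i := by nlinarith
    have := mul_pos h hxx
    simp_all only [mul_zero, zero_mul, mul_one, one_mul]; linarith
  · have : 1 + d.x i * d.x j ≤ d.c i * d.c j := by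
      apply abs_le_of_sq_le_sq' _ (by positivity) |>.2
      rw [mul_pow, hsi, hsj]; nlinarith [sq_nonneg (d.x i - d.x j)]
    nlinarith

theorem Valid.z_pos {i j : ι} (h : 0 < d.e i * d.e j + d.h i j) : 0 < d.z i j := by
  have := hd.y_pos h
  unfold z
  rcases hd.lam01 with hl | hl <;> rw [hl] <;> positivity

theorem Valid.gam_eq (i j k : ι) :
    d.z i j * d.a i k - d.n i j k * d.a i j = d.gam i j k := by
  have hsi := hd.c_sq i
  have hsj := hd.c_sq j
  have hsk := hd.c_sq k
  have hci := hd.c_pos i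
  have hcj := hd.c_pos j
  have hck := hd.c_pos k
  unfold z n gam a y
  rcases hd.lam01 with hl | hl <;> rw [hl] at hsi hsj hsk ⊢
  · have hi : d.c i = 1 := by nlinarith
    have hj : d.c j = 1 := by nlinarith
    have hk : d.c k = 1 := by nlinarith
    rw [hi, hj, hk]; ring
  · have h1 : d.e i * d.x i ^ 2 = d.c i ^ 2 - 1 := by linarith
    have h2 : d.e j * d.x j ^ 2 = d.c j ^ 2 - 1 := by linarith
    have h3 : d.e k * d.x k ^ 2 = d.c k ^ 2 - 1 := by linarith
    rw [show (d.e i * d.e j - d.h i j ^ 2) * (d.x i * d.x j) ^ 2 =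
      (d.e i * d.x i ^ 2) * (d.e j * d.x j ^ 2) - (d.h i j * (d.x i * d.x j)) ^ 2 by ring,
      show (d.e j * d.h i k + d.h i j * d.h j k) * (d.x i * d.x j ^ 2 * d.x k) =
      (d.e j * d.x j ^ 2) * (d.h i k * (d.x i * d.x k)) +
        (d.h i j * (d.x i * d.x j)) * (d.h j k * (d.x j * d.x k)) by ring,
      show (d.e i * d.h j k + d.h i j * d.h i k) * (d.x i ^ 2 * d.x j * d.x k) =
      (d.e i * d.x i ^ 2) * (d.h j k * (d.x j * d.x k)) +
        (d.h i j * (d.x i * d.x j)) * (d.h i k * (d.x i * d.x k)) by ring, h1, h2]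
    ring

theorem Valid.gam_dichotomy {i j k : ι} (hf : d.FaceCond i j k) :
    0 ≤ d.gam i j k ∨ 0 ≤ d.gam i k j := by
  by_contra! hcon
  obtain ⟨h3, h2⟩ := hcon
  have hi := hd.x_pos i
  have hj := hd.x_pos j
  have hk := hd.x_pos k
  refine weights_dichotomy (hd.e01 i) (hd.e01 j) (hd.e01 k) hf.edge_ij hf.edge_ik hf.edge_jk
    hf.face_i hf.face_j hf.face_k (div_pos (hd.c_pos i) hi) (div_pos (hd.c_pos j) hj)
    (div_pos (hd.c_pos k) hk) ?_ ?_
  · refine nonpos_of_mul_nonpos_right (a := d.x i ^ 2 * d.x j ^ 2 * d.x k) ?_ (by positivity)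
    refine le_of_eq_of_le ?_ h3.le
    unfold gam
    field_simp
  · refine nonpos_of_mul_nonpos_right (a := d.x i ^ 2 * d.x k ^ 2 * d.x j) ?_ (by positivity)
    refine le_of_eq_of_le ?_ h2.le
    unfold gam
    rw [hd.h_symm k j]
    field_simp

theorem Valid.p_nonneg {i j k : ι} (hf : d.FaceCond i j k)
    (h3 : 0 ≤ d.gam i j k) (h2 : 0 ≤ d.gam i k j) : 0 ≤ d.p i j k := by
  have hz3 := hd.z_pos hf.edge_ij
  have hz2 := hd.z_pos hf.edge_ik
  have hy3 := hd.y_pos hf.edge_ij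
  have hy2 := hd.y_pos hf.edge_ik
  have hl : 0 ≤ d.lam := by rcases hd.lam01 with h | h <;> rw [h]; norm_num
  have key : d.p i j k = (1 + d.lam * d.y i j) * (d.gam i j k / d.z i j) +
      (1 + d.lam * d.y i k) * (d.gam i k j / d.z i k) := by
    rw [← hd.gam_eq, ← hd.gam_eq, p]
    field_simp
    unfold n z
    rw [hd.y_comm k i, hd.y_comm k j, hd.y_comm j i]
    ring
  rw [key]
  positivity

/-- The quadratic form of the angle variations is minus a square, up to multiples of `disc`. -/
theorem Valid.sum_identity {i j k : ι} (hf : d.FaceCond i j k) (ξ : ι → ℝ) :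
    ξ i * d.r ξ i j k + ξ j * d.r ξ j k i + ξ k * d.r ξ k i j =
    - d.p i j k * d.ell ξ i j k ^ 2 + d.disc i j k * d.rem ξ i j k := by
  have hz3 := (hd.z_pos hf.edge_ij).ne'
  have hz2 := (hd.z_pos hf.edge_ik).ne'
  have hz1 := (hd.z_pos hf.edge_jk).ne'
  have hD1 : d.disc i j k = d.z i j * d.z j k - d.n j i k ^ 2 := by
    unfold disc n z; rw [hd.y_comm j i]; ring
  have hD2 : d.disc i j k = d.z i k * d.z j k - d.n k i j ^ 2 := by
    unfold disc n z; rw [hd.y_comm k i, hd.y_comm k j]; ring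
  have hc1 : d.n i j k * d.z j k + d.n j i k * d.n k i j =
      (1 + d.lam * d.y j k) * d.disc i j k := by
    unfold disc n z; rw [hd.y_comm k i, hd.y_comm k j, hd.y_comm j i]; ring
  have hsym3 : d.z i j * d.a i k - d.n i j k * d.a i j =
      d.z i j * d.a j k - d.n j i k * d.a j i := by
    rw [hd.gam_eq, hd.gam_comm, ← hd.gam_eq, hd.z_comm]
  have hsym2 : d.z i k * d.a i j - d.n i j k * d.a i k =
      d.z i k * d.a k j - d.n k i j * d.a k i := by
    have h1 := hd.gam_eq i k j
    have h2 := hd.gam_eq k i j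
    rw [hd.gam_comm k i j, ← h1, hd.z_comm k i, hd.n_comm i k j] at h2
    exact h2.symm
  have A2 : d.n k i j / d.z j k * (d.n k i j / d.z i k) =
      1 - d.disc i j k / (d.z j k * d.z i k) := by
    rw [hD2]; field_simp; ring
  have A3 : d.n j i k / d.z j k * (d.n j i k / d.z i j) =
      1 - d.disc i j k / (d.z j k * d.z i j) := by
    rw [hD1]; field_simp; ring
  have B3 : d.n i j k / d.z i j + d.n k i j / d.z j k * (d.n j i k / d.z i j) =
      (1 + d.lam * d.y j k) * d.disc i j k / (d.z j k * d.z i j) := by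
    rw [← hc1]; field_simp
  have B2 : d.n i j k / d.z i k + d.n j i k / d.z j k * (d.n k i j / d.z i k) =
      (1 + d.lam * d.y j k) * d.disc i j k / (d.z j k * d.z i k) := by
    rw [← hc1]; field_simp
  have S3 : d.a j k - d.n j i k / d.z i j * d.a j i =
      d.a i k - d.n i j k / d.z i j * d.a i j := by
    field_simp; linarith
  have S2 : d.a k j - d.n k i j / d.z i k * d.a k i =
      d.a i j - d.n i j k / d.z i k * d.a i k := by
    field_simp; linarith
  have r1 : d.r ξ i j k = - d.p i j k * d.ell ξ i j k +
      d.disc i j k * (d.bet i j k * ξ j + d.bet i k j * ξ k) := by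
    unfold r dy p ell bet
    rw [hd.z_comm k j, hd.y_comm k j]
    linear_combination ξ j * S3 + ξ k * S2 - ξ j * d.a i k * A2 - ξ j * d.a i j * B3 -
      ξ k * d.a i j * A3 - ξ k * d.a i k * B2
  have r2 : d.r ξ j k i = - (d.n k i j / d.z j k) * d.r ξ i j k + d.disc i j k * d.eta ξ i j k := by
    unfold r eta
    rw [hd.z_comm j i, d.dy_comm ξ j i, d.dy_comm ξ k i, hd.n_comm k j i, hd.n_comm i j k] at *
    linear_combination (- d.dy ξ i k) * A2 - d.dy ξ i j * B3
  have r3 : d.r ξ k i j = - (d.n j i k / d.z j k) * d.r ξ i j k + d.disc i j k * d.eta ξ i k j := by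
    unfold r eta
    rw [hd.z_comm k j, hd.z_comm k i, d.dy_comm ξ k i, d.dy_comm ξ k j, hd.n_comm j k i,
      hd.n_comm i k j, hd.y_comm k j]
    linear_combination (- d.dy ξ i j) * A3 - d.dy ξ i k * B2
  rw [r2, r3]
  unfold rem
  have hl : d.ell ξ i j k =
    ξ i - (d.n k i j / d.z j k) * ξ j - (d.n j i k / d.z j k) * ξ k := rfl
  linear_combination d.ell ξ i j k * r1 - d.r ξ i j k * hl

theorem Valid.disc_rotate (i j k : ι) : d.disc j k i = d.disc i j k := by
  unfold disc n z
  rw [hd.y_comm j i, hd.y_comm k i]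
  ring

theorem Valid.sum_le {i j k : ι} (hf : d.FaceCond i j k) (ξ : ι → ℝ) :
    ξ i * d.r ξ i j k + ξ j * d.r ξ j k i + ξ k * d.r ξ k i j ≤ d.disc i j k * d.rem ξ i j k ∨
    ξ i * d.r ξ i j k + ξ j * d.r ξ j k i + ξ k * d.r ξ k i j ≤ d.disc i j k * d.rem ξ j k i ∨
    ξ i * d.r ξ i j k + ξ j * d.r ξ j k i + ξ k * d.r ξ k i j ≤ d.disc i j k * d.rem ξ k i j := by
  have hf' := hd.faceCond_rotate hf
  have hf'' := hd.faceCond_rotate hf'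
  have e1 := hd.sum_identity hf ξ
  have e2 := hd.sum_identity hf' ξ
  have e3 := hd.sum_identity hf'' ξ
  rw [hd.disc_rotate] at e2
  rw [hd.disc_rotate, hd.disc_rotate] at e3
  have g1 := hd.gam_dichotomy hf
  have g2 := hd.gam_dichotomy hf'
  have g3 := hd.gam_dichotomy hf''
  have p1 := hd.p_nonneg hf
  have p2 := hd.p_nonneg hf'
  have p3 := hd.p_nonneg hf''
  rw [hd.gam_comm j i] at g2 p2
  rw [hd.gam_comm k i, hd.gam_comm k j] at g3 p3
  have key : 0 ≤ d.p i j k ∨ 0 ≤ d.p j k i ∨ 0 ≤ d.p k i j := by tauto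
  rcases key with h | h | h
  · left; nlinarith [mul_nonneg h (sq_nonneg (d.ell ξ i j k))]
  · right; left; nlinarith [mul_nonneg h (sq_nonneg (d.ell ξ j k i))]
  · right; right; nlinarith [mul_nonneg h (sq_nonneg (d.ell ξ k i j))]

omit hd in
theorem rem_smul (t : ℝ) (ξ : ι → ℝ) (i j k : ι) :
    d.rem (t • ξ) i j k = t ^ 2 * d.rem ξ i j k := by
  simp only [rem, ell, eta, dy, Pi.smul_apply, smul_eq_mul]
  ring

end ConformalData

/-- The derivative of `arccos (n / (√z √w))` where the triangle is nondegenerate. -/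
theorem hasDerivAt_arccos_div_sqrt {n z w : ℝ → ℝ} {n' z' w' s : ℝ} (hn : HasDerivAt n n' s)
    (hz : HasDerivAt z z' s) (hw : HasDerivAt w w' s) (hz0 : 0 < z s) (hw0 : 0 < w s)
    (hD : 0 < z s * w s - n s ^ 2) :
    HasDerivAt (fun t => arccos (n t / (√(z t) * √(w t))))
      ((n s * (z' / (2 * z s) + w' / (2 * w s)) - n') / √(z s * w s - n s ^ 2)) s := by
  have hsz := Real.sqrt_pos.2 hz0
  have hsw := Real.sqrt_pos.2 hw0
  have ez := Real.sq_sqrt hz0.le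
  have ew := Real.sq_sqrt hw0.le
  have hq : 1 - (n s / (√(z s) * √(w s))) ^ 2 = (z s * w s - n s ^ 2) / (z s * w s) := by
    rw [div_pow, mul_pow, ez, ew]; field_simp
  have hpos : 0 < 1 - (n s / (√(z s) * √(w s))) ^ 2 := by rw [hq]; positivity
  have hd := (hn.div ((hz.sqrt hz0.ne').mul (hw.sqrt hw0.ne')) (mul_pos hsz hsw).ne')
  have ha := (Real.hasDerivAt_arccos (x := n s / (√(z s) * √(w s)))
    (by rintro h; rw [h] at hpos; norm_num at hpos)
    (by rintro h; rw [h] at hpos; norm_num at hpos)).comp s hd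
  refine ha.congr_deriv ?_
  rw [hq, Real.sqrt_div hD.le, Real.sqrt_mul hz0.le]
  have hsD := Real.sqrt_pos.2 hD
  simp only [Pi.mul_apply]
  generalize √(z s * w s - n s ^ 2) = D at *
  rw [← ez, ← ew]
  simp only [Real.sqrt_sq hsz.le, Real.sqrt_sq hsw.le]
  field_simp
  ring

/-- A continuous function on `[a, b]` whose derivative is at most `C` at every point where its value
lies outside a finite set increases by at most `C * (b - a)`. -/
theorem sub_le_mul_of_deriv_le_off_finite {g : ℝ → ℝ} {C : ℝ} (hC : 0 ≤ C) (S : Finset ℝ) :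
    ∀ {a b : ℝ}, a ≤ b → ContinuousOn g (Set.Icc a b) →
    (∀ s ∈ Set.Ioo a b, g s ∉ S → ∃ g', HasDerivAt g g' s ∧ g' ≤ C) →
    g b - g a ≤ C * (b - a) := by
  induction S using Finset.induction_on with
  | empty =>
    intro a b hab hg hd
    refine (convex_Icc a b).image_sub_le_mul_sub_of_deriv_le hg ?_ ?_ a
      (Set.left_mem_Icc.2 hab) b (Set.right_mem_Icc.2 hab) hab
    · intro s hs
      rw [interior_Icc] at hs
      obtain ⟨g', h, -⟩ := hd s hs (by simp)
      exact h.differentiableAt.differentiableWithinAt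
    · intro s hs
      rw [interior_Icc] at hs
      obtain ⟨g', h, h'⟩ := hd s hs (by simp)
      rwa [h.deriv]
  | insert v S _ ih =>
    intro a b hab hg hd
    by_cases hv : ∃ s ∈ Set.Icc a b, g s = v
    · have hcomp : IsCompact (Set.Icc a b ∩ g ⁻¹' {v}) :=
        isCompact_Icc.of_isClosed_subset
          (hg.preimage_isClosed_of_isClosed isClosed_Icc isClosed_singleton) Set.inter_subset_left
      have hne : (Set.Icc a b ∩ g ⁻¹' {v}).Nonempty := by
        obtain ⟨s, hs, rfl⟩ := hv
        exact ⟨s, hs, rfl⟩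
      obtain ⟨p, ⟨hp, hgp⟩, hpl⟩ := hcomp.exists_isLeast hne
      obtain ⟨q, ⟨hq, hgq⟩, hqg⟩ := hcomp.exists_isGreatest hne
      have hpq : p ≤ q := hpl ⟨hq, hgq⟩
      have h1 := ih hp.1 (hg.mono (Set.Icc_subset_Icc le_rfl hp.2)) fun s hs hsS =>
        hd s ⟨hs.1, hs.2.trans_le hp.2⟩ (by
          rw [Finset.mem_insert, not_or]
          exact ⟨fun h => not_lt.2 (hpl ⟨⟨hs.1.le, hs.2.le.trans hp.2⟩, h⟩) hs.2, hsS⟩)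
      have h2 := ih hq.2 (hg.mono (Set.Icc_subset_Icc hq.1 le_rfl)) fun s hs hsS =>
        hd s ⟨hq.1.trans_lt hs.1, hs.2⟩ (by
          rw [Finset.mem_insert, not_or]
          exact ⟨fun h => not_lt.2 (hqg ⟨⟨hq.1.trans hs.1.le, hs.2.le⟩, h⟩) hs.1, hsS⟩)
      simp only [Set.mem_preimage, Set.mem_singleton_iff] at hgp hgq
      rw [hgp] at h1
      rw [hgq] at h2
      nlinarith [mul_nonneg hC (sub_nonneg.2 hpq)]
    · push Not at hv
      refine ih hab hg fun s hs hsS => hd s hs ?_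
      rw [Finset.mem_insert, not_or]
      exact ⟨hv s (Set.Ioo_subset_Icc_self hs), hsS⟩

theorem arccos_eq_zero_or_pi {x : ℝ} (h : 1 ≤ x ^ 2) : arccos x = 0 ∨ arccos x = π := by
  rcases le_abs.1 ((one_le_sq_iff_one_le_abs x).1 h) with h | h
  · exact Or.inl (arccos_eq_zero.2 h)
  · exact Or.inr (arccos_eq_pi.2 (by linarith))

/-- A family of discrete conformal structures parametrized by coordinates `u i ∈ dom i` at the
vertices, for which the variation of edge lengths has the same shape in the Euclidean (`lam = 0`)
and hyperbolic (`lam = 1`) backgrounds. -/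
structure Background (N : ℕ) where
  lam : ℝ
  eps : Fin N → ℝ
  eta : Fin N → Fin N → ℝ
  X : Fin N → ℝ → ℝ
  C : Fin N → ℝ → ℝ
  dom : Fin N → Set ℝ
  lam01 : lam = 0 ∨ lam = 1
  eps01 : ∀ i, eps i = 0 ∨ eps i = 1
  eta_symm : ∀ i j, eta i j = eta j i
  dom_convex : ∀ i, Convex ℝ (dom i)
  X_pos : ∀ i, ∀ u ∈ dom i, 0 < X i u
  C_pos : ∀ i, ∀ u ∈ dom i, 0 < C i u
  C_sq : ∀ i, ∀ u ∈ dom i, C i u ^ 2 = 1 + lam * eps i * X i u ^ 2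
  X_deriv : ∀ i, ∀ u ∈ dom i, HasDerivAt (X i) (X i u * C i u) u
  C_deriv : ∀ i, ∀ u ∈ dom i, HasDerivAt (C i) (lam * eps i * X i u ^ 2) u

namespace Background

variable {N : ℕ} (B : Background N)

/-- The domain of the coordinates. -/
def Dom : Set (Fin N → ℝ) := {u | ∀ i, u i ∈ B.dom i}

/-- The conformal data at the coordinates `u`. -/
def data (u : Fin N → ℝ) : ConformalData (Fin N) where
  lam := B.lam
  e := B.eps
  x := fun i => B.X i (u i)
  c := fun i => B.C i (u i)
  h := B.eta

/-- The extended angle at `i`: `arccos` is constant outside `[-1, 1]`, which accounts for degenerate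
triangles. -/
noncomputable def angle (u : Fin N → ℝ) (i j k : Fin N) : ℝ :=
  arccos ((B.data u).n i j k / (√((B.data u).z i j) * √((B.data u).z i k)))

variable {B}

theorem valid {u : Fin N → ℝ} (hu : u ∈ B.Dom) : (B.data u).Valid where
  lam01 := B.lam01
  e01 := B.eps01
  x_pos i := B.X_pos i _ (hu i)
  c_pos i := B.C_pos i _ (hu i)
  c_sq i := B.C_sq i _ (hu i)
  h_symm := B.eta_symm

theorem continuousOn_x (i : Fin N) : ContinuousOn (fun u => (B.data u).x i) B.Dom :=
  ContinuousOn.comp (f := fun u : Fin N → ℝ => u i) (t := B.dom i)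
    (fun u hu => (B.X_deriv i u hu).continuousAt.continuousWithinAt)
    (continuous_apply i).continuousOn fun _ hu => hu i

theorem continuousOn_c (i : Fin N) : ContinuousOn (fun u => (B.data u).c i) B.Dom :=
  ContinuousOn.comp (f := fun u : Fin N → ℝ => u i) (t := B.dom i)
    (fun u hu => (B.C_deriv i u hu).continuousAt.continuousWithinAt)
    (continuous_apply i).continuousOn fun _ hu => hu i

theorem continuousOn_y (i j : Fin N) : ContinuousOn (fun u => (B.data u).y i j) B.Dom := by
  have h1 := B.continuousOn_x i
  have h2 := B.continuousOn_x j
  have h3 := B.continuousOn_c i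
  have h4 := B.continuousOn_c j
  have e : ∀ u, (B.data u).e = B.eps := fun _ => rfl
  have e' : ∀ u, (B.data u).h = B.eta := fun _ => rfl
  have e'' : ∀ u, (B.data u).lam = B.lam := fun _ => rfl
  simp only [ConformalData.y, e, e', e'']
  fun_prop

theorem continuousOn_a (i j : Fin N) : ContinuousOn (fun u => (B.data u).a i j) B.Dom := by
  have h1 := B.continuousOn_x i
  have h2 := B.continuousOn_x j
  have h3 := B.continuousOn_c i
  have h4 := B.continuousOn_c j
  have e : ∀ u, (B.data u).e = B.eps := fun _ => rfl
  have e' : ∀ u, (B.data u).h = B.eta := fun _ => rfl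
  simp only [ConformalData.a, e, e']
  fun_prop

theorem continuousOn_z (i j : Fin N) : ContinuousOn (fun u => (B.data u).z i j) B.Dom := by
  have h1 := B.continuousOn_y i j
  have e'' : ∀ u, (B.data u).lam = B.lam := fun _ => rfl
  simp only [ConformalData.z, e'']
  fun_prop

theorem continuousOn_n (i j k : Fin N) : ContinuousOn (fun u => (B.data u).n i j k) B.Dom := by
  have h1 := B.continuousOn_y i j
  have h2 := B.continuousOn_y i k
  have h3 := B.continuousOn_y j k
  have e'' : ∀ u, (B.data u).lam = B.lam := fun _ => rfl
  simp only [ConformalData.n, e'']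
  fun_prop

theorem continuousOn_disc (i j k : Fin N) :
    ContinuousOn (fun u => (B.data u).disc i j k) B.Dom := by
  have h1 := B.continuousOn_z i j
  have h2 := B.continuousOn_z i k
  have h3 := B.continuousOn_n i j k
  simp only [ConformalData.disc]
  fun_prop

theorem continuousOn_angle {i j k : Fin N} (hij : ∀ u ∈ B.Dom, 0 < (B.data u).z i j)
    (hik : ∀ u ∈ B.Dom, 0 < (B.data u).z i k) :
    ContinuousOn (fun u => B.angle u i j k) B.Dom := by
  refine Real.continuous_arccos.comp_continuousOn ((B.continuousOn_n i j k).div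
    ((B.continuousOn_z i j).sqrt.mul (B.continuousOn_z i k).sqrt) fun u hu => ?_)
  have := Real.sqrt_pos.2 (hij u hu)
  have := Real.sqrt_pos.2 (hik u hu)
  positivity

theorem continuousOn_rem {i j k : Fin N} (hij : ∀ u ∈ B.Dom, (B.data u).z i j ≠ 0)
    (hik : ∀ u ∈ B.Dom, (B.data u).z i k ≠ 0) (hjk : ∀ u ∈ B.Dom, (B.data u).z j k ≠ 0)
    (hkj : ∀ u ∈ B.Dom, (B.data u).z k j ≠ 0) :
    ContinuousOn (fun q : (Fin N → ℝ) × (Fin N → ℝ) => (B.data q.1).rem q.2 i j k)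
      (B.Dom ×ˢ Set.univ) := by
  have hfst : Set.MapsTo (Prod.fst : (Fin N → ℝ) × (Fin N → ℝ) → _) (B.Dom ×ˢ Set.univ) B.Dom :=
    fun q hq => hq.1
  have lift : ∀ {f : (Fin N → ℝ) → ℝ}, ContinuousOn f B.Dom →
      ContinuousOn (fun q : (Fin N → ℝ) × (Fin N → ℝ) => f q.1) (B.Dom ×ˢ Set.univ) :=
    fun hf => hf.comp continuousOn_fst hfst
  have a1 := lift (B.continuousOn_a i k)
  have a2 := lift (B.continuousOn_a i j)
  have a3 := lift (B.continuousOn_a k i)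
  have a4 := lift (B.continuousOn_a j i)
  have z1 := lift (B.continuousOn_z j k)
  have z2 := lift (B.continuousOn_z i k)
  have z3 := lift (B.continuousOn_z i j)
  have z4 := lift (B.continuousOn_z k j)
  have y1 := lift (B.continuousOn_y j k)
  have y2 := lift (B.continuousOn_y k j)
  have n1 := lift (B.continuousOn_n k i j)
  have n2 := lift (B.continuousOn_n j i k)
  have e'' : ∀ u, (B.data u).lam = B.lam := fun _ => rfl
  have w1 : ∀ q ∈ B.Dom ×ˢ (Set.univ : Set (Fin N → ℝ)), (B.data q.1).z i j ≠ 0 :=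
    fun q hq => hij _ hq.1
  have w2 : ∀ q ∈ B.Dom ×ˢ (Set.univ : Set (Fin N → ℝ)), (B.data q.1).z i k ≠ 0 :=
    fun q hq => hik _ hq.1
  have w3 : ∀ q ∈ B.Dom ×ˢ (Set.univ : Set (Fin N → ℝ)), (B.data q.1).z j k ≠ 0 :=
    fun q hq => hjk _ hq.1
  have w4 : ∀ q ∈ B.Dom ×ˢ (Set.univ : Set (Fin N → ℝ)), (B.data q.1).z k j ≠ 0 :=
    fun q hq => hkj _ hq.1
  simp only [ConformalData.rem, ConformalData.ell, ConformalData.eta, ConformalData.bet,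
    ConformalData.dy, e'']
  fun_prop (disch := first
    | assumption
    | exact fun q hq => mul_ne_zero (hjk _ hq.1) (hij _ hq.1)
    | exact fun q hq => mul_ne_zero (hjk _ hq.1) (hik _ hq.1)
    | exact fun q hq => mul_ne_zero (hkj _ hq.1) (hij _ hq.1)
    | exact fun q hq => mul_ne_zero (hkj _ hq.1) (hik _ hq.1))

theorem hasDerivAt_y {v ξ : Fin N → ℝ} {s : ℝ} (hs : v + s • ξ ∈ B.Dom) (i j : Fin N) :
    HasDerivAt (fun t : ℝ => (B.data (v + t • ξ)).y i j) ((B.data (v + s • ξ)).dy ξ i j) s := by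
  have line : ∀ i, HasDerivAt (fun t : ℝ => (v + t • ξ) i) (ξ i) s := fun i => by
    simpa using ((hasDerivAt_id s).mul_const (ξ i)).const_add (v i)
  have hx : ∀ i, HasDerivAt (fun t : ℝ => B.X i ((v + t • ξ) i)) _ s := fun i =>
    (B.X_deriv i _ (hs i)).comp s (line i)
  have hc : ∀ i, HasDerivAt (fun t : ℝ => B.C i ((v + t • ξ) i)) _ s := fun i =>
    (B.C_deriv i _ (hs i)).comp s (line i)
  have key := (((((hc i).mul (hc j)).sub_const 1).const_mul B.lam).add
    ((((((hx i).pow 2).const_mul (B.eps i)).add (((hx j).pow 2).const_mul (B.eps j))).div_const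
      2).const_mul (1 - B.lam))).add (((hx i).mul (hx j)).const_mul (B.eta i j))
  refine key.congr_deriv ?_
  have hci := B.C_pos i _ (hs i)
  have hcj := B.C_pos j _ (hs j)
  have hsi := B.C_sq i _ (hs i)
  have hsj := B.C_sq j _ (hs j)
  simp only [ConformalData.dy, ConformalData.a, data, B.eta_symm j i]
  rcases B.lam01 with hl | hl <;> rw [hl] at hsi hsj ⊢
  · have hi : B.C i ((v + s • ξ) i) = 1 := by nlinarith
    have hj : B.C j ((v + s • ξ) j) = 1 := by nlinarith
    rw [hi, hj]
    push_cast
    ring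
  · push_cast
    ring

theorem hasDerivAt_angle {v ξ : Fin N → ℝ} {s : ℝ} (hs : v + s • ξ ∈ B.Dom) {i j k : Fin N}
    (hij : 0 < (B.data (v + s • ξ)).z i j) (hik : 0 < (B.data (v + s • ξ)).z i k)
    (hD : 0 < (B.data (v + s • ξ)).disc i j k) :
    HasDerivAt (fun t : ℝ => B.angle (v + t • ξ) i j k)
      ((B.data (v + s • ξ)).r ξ i j k / √((B.data (v + s • ξ)).disc i j k)) s := by
  have hv := valid hs
  have hij' := B.hasDerivAt_y hs i j
  have hik' := B.hasDerivAt_y hs i k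
  have hjk' := B.hasDerivAt_y hs j k
  have zd : ∀ l m, HasDerivAt (fun t : ℝ => (B.data (v + t • ξ)).z l m) _ s := fun l m =>
    ((B.hasDerivAt_y hs l m).const_mul 2).add (((B.hasDerivAt_y hs l m).pow 2).const_mul B.lam)
  have nd : HasDerivAt (fun t : ℝ => (B.data (v + t • ξ)).n i j k) _ s :=
    ((hij'.add hik').sub hjk').add ((hij'.mul hik').const_mul B.lam)
  refine (hasDerivAt_arccos_div_sqrt nd (zd i j) (zd i k) hij hik hD).congr_deriv ?_
  change _ / √((B.data (v + s • ξ)).disc i j k) = _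
  congr 1
  have e'' : B.lam = (B.data (v + s • ξ)).lam := rfl
  have z1 := hv.y_comm k i
  have z2 := hv.y_comm j i
  have z3 := hv.y_comm k j
  rw [e'']
  unfold ConformalData.r
  generalize B.data (v + s • ξ) = d at *
  field_simp
  unfold ConformalData.n ConformalData.z
  rw [z1, z2, z3]
  push_cast
  ring

/-- The structure conditions on the weights of the face `{i, j, k}`. -/
def Face (B : Background N) (i j k : Fin N) : Prop :=
  0 < B.eps i * B.eps j + B.eta i j ∧ 0 < B.eps i * B.eps k + B.eta i k ∧
    0 < B.eps j * B.eps k + B.eta j k ∧ 0 ≤ B.eps i * B.eta j k + B.eta i j * B.eta i k ∧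
    0 ≤ B.eps j * B.eta i k + B.eta i j * B.eta j k ∧
    0 ≤ B.eps k * B.eta i j + B.eta i k * B.eta j k

theorem Face.faceCond {i j k : Fin N} (h : B.Face i j k) (u : Fin N → ℝ) :
    (B.data u).FaceCond i j k :=
  ⟨h.1, h.2.1, h.2.2.1, h.2.2.2.1, h.2.2.2.2.1, h.2.2.2.2.2⟩

theorem Face.rotate {i j k : Fin N} (h : B.Face i j k) : B.Face j k i := by
  obtain ⟨h1, h2, h3, h4, h5, h6⟩ := h
  refine ⟨h3, ?_, ?_, ?_, ?_, ?_⟩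
  · rwa [B.eta_symm j i, mul_comm]
  · rwa [B.eta_symm k i, mul_comm]
  · rwa [B.eta_symm k i, B.eta_symm j i, mul_comm (B.eta j k)]
  · rwa [B.eta_symm k i, B.eta_symm j i, mul_comm (B.eta j k)]
  · rwa [B.eta_symm j i, B.eta_symm k i]

theorem exists_rem_bound {i j k : Fin N} (h : B.Face i j k) {K : Set (Fin N → ℝ)}
    (hK : IsCompact K) (hKD : K ⊆ B.Dom) :
    ∃ C, 0 ≤ C ∧
      ∀ u ∈ K, ∀ ξ, √((B.data u).disc i j k) * (B.data u).rem ξ i j k ≤ C * ‖ξ‖ ^ 2 := by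
  have zij : ∀ u ∈ B.Dom, (B.data u).z i j ≠ 0 := fun u hu => ((valid hu).z_pos h.1).ne'
  have zik : ∀ u ∈ B.Dom, (B.data u).z i k ≠ 0 := fun u hu => ((valid hu).z_pos h.2.1).ne'
  have zjk : ∀ u ∈ B.Dom, (B.data u).z j k ≠ 0 := fun u hu => ((valid hu).z_pos h.2.2.1).ne'
  have zkj : ∀ u ∈ B.Dom, (B.data u).z k j ≠ 0 := fun u hu => by
    rw [(valid hu).z_comm]; exact zjk u hu
  have hcont : ContinuousOn (fun q : (Fin N → ℝ) × (Fin N → ℝ) =>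
      √((B.data q.1).disc i j k) * (B.data q.1).rem q.2 i j k)
      (K ×ˢ Metric.closedBall 0 1) := by
    refine ContinuousOn.mono (s := B.Dom ×ˢ Set.univ) ?_
      (Set.prod_mono hKD (Set.subset_univ _))
    exact ((B.continuousOn_disc i j k).comp continuousOn_fst fun q hq => hq.1).sqrt.mul
      (continuousOn_rem zij zik zjk zkj)
  obtain ⟨C, hC⟩ := (hK.prod (isCompact_closedBall 0 1)).exists_bound_of_continuousOn hcont
  refine ⟨|C|, abs_nonneg C, fun u hu ξ => ?_⟩
  rcases eq_or_ne ξ 0 with rfl | hξ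
  · have : (B.data u).rem 0 i j k = 0 := by
      have := (B.data u).rem_smul 0 0 i j k
      simpa using this
    rw [this]; simp
  · have hpos : 0 < ‖ξ‖ := norm_pos_iff.2 hξ
    have hmem : (u, ‖ξ‖⁻¹ • ξ) ∈ K ×ˢ Metric.closedBall (0 : Fin N → ℝ) 1 := by
      refine ⟨hu, ?_⟩
      rw [mem_closedBall_zero_iff, norm_smul, norm_inv, norm_norm, inv_mul_cancel₀ hpos.ne']
    have hb := (le_abs_self _).trans ((hC _ hmem).trans (le_abs_self C))
    simp only [ConformalData.rem_smul] at hb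
    have := mul_le_mul_of_nonneg_right hb (sq_nonneg ‖ξ‖)
    refine le_of_eq_of_le ?_ this
    field_simp

/-- The extended angles of a face satisfy a one-sided Lipschitz estimate on compact convex sets. -/
theorem Face.exists_one_sided {i j k : Fin N} (h : B.Face i j k) {K : Set (Fin N → ℝ)}
    (hK : IsCompact K) (hKc : Convex ℝ K) (hKD : K ⊆ B.Dom) :
    ∃ C, 0 ≤ C ∧ ∀ u ∈ K, ∀ v ∈ K,
      (u i - v i) * (B.angle u i j k - B.angle v i j k) +
      (u j - v j) * (B.angle u j k i - B.angle v j k i) +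
      (u k - v k) * (B.angle u k i j - B.angle v k i j) ≤ C * ‖u - v‖ ^ 2 := by
  obtain ⟨C₁, hC₁, h₁⟩ := exists_rem_bound h hK hKD
  obtain ⟨C₂, hC₂, h₂⟩ := exists_rem_bound h.rotate hK hKD
  obtain ⟨C₃, hC₃, h₃⟩ := exists_rem_bound h.rotate.rotate hK hKD
  refine ⟨C₁ + C₂ + C₃, by positivity, fun u hu v hv => ?_⟩
  set ξ := u - v with hξ
  have hnn : 0 ≤ ‖ξ‖ ^ 2 := sq_nonneg _
  have hseg : ∀ s ∈ Set.Icc (0 : ℝ) 1, v + s • ξ ∈ K := fun s hs => by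
    have := hKc.add_smul_sub_mem hv hu hs
    exact this
  have zij : ∀ u ∈ B.Dom, 0 < (B.data u).z i j := fun u hu => (valid hu).z_pos h.1
  have zik : ∀ u ∈ B.Dom, 0 < (B.data u).z i k := fun u hu => (valid hu).z_pos h.2.1
  have zjk : ∀ u ∈ B.Dom, 0 < (B.data u).z j k := fun u hu => (valid hu).z_pos h.2.2.1
  have zji : ∀ u ∈ B.Dom, 0 < (B.data u).z j i := fun u hu => by
    rw [(valid hu).z_comm]; exact zij u hu
  have zki : ∀ u ∈ B.Dom, 0 < (B.data u).z k i := fun u hu => by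
    rw [(valid hu).z_comm]; exact zik u hu
  have zkj : ∀ u ∈ B.Dom, 0 < (B.data u).z k j := fun u hu => by
    rw [(valid hu).z_comm]; exact zjk u hu
  let g : ℝ → ℝ := fun s => ξ i * B.angle (v + s • ξ) i j k + ξ j * B.angle (v + s • ξ) j k i +
    ξ k * B.angle (v + s • ξ) k i j
  have hcont : ContinuousOn g (Set.Icc 0 1) := by
    have hline : ContinuousOn (fun s : ℝ => v + s • ξ) (Set.Icc 0 1) := by fun_prop
    have hm : Set.MapsTo (fun s : ℝ => v + s • ξ) (Set.Icc 0 1) B.Dom :=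
      fun s hs => hKD (hseg s hs)
    exact (((continuousOn_angle zij zik).comp hline hm).const_mul _ |>.add
      (((continuousOn_angle zjk zji).comp hline hm).const_mul _)).add
      (((continuousOn_angle zki zkj).comp hline hm).const_mul _)
  let A : Finset ℝ := {0, π}
  let S : Finset ℝ := (A ×ˢ (A ×ˢ A)).image fun q => ξ i * q.1 + ξ j * q.2.1 + ξ k * q.2.2
  have key := sub_le_mul_of_deriv_le_off_finite (g := g) (C := (C₁ + C₂ + C₃) * ‖ξ‖ ^ 2)
    (by positivity) S zero_le_one hcont fun s hs hsS => by
      have hsK := hseg s (Set.Ioo_subset_Icc_self hs)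
      have hsD := hKD hsK
      have hval := valid hsD
      have rot1 := hval.disc_rotate i j k
      have rot2 := hval.disc_rotate j k i
      by_cases hD : 0 < (B.data (v + s • ξ)).disc i j k
      · refine ⟨_, (((hasDerivAt_angle hsD (zij _ hsD) (zik _ hsD) hD).const_mul (ξ i)).add
          ((hasDerivAt_angle hsD (zjk _ hsD) (zji _ hsD) (by rwa [rot1])).const_mul (ξ j))).add
          ((hasDerivAt_angle hsD (zki _ hsD) (zkj _ hsD) (by rwa [rot2, rot1])).const_mul (ξ k)),
          ?_⟩
        have b₁ := h₁ _ hsK ξ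
        have b₂ := h₂ _ hsK ξ
        have b₃ := h₃ _ hsK ξ
        rw [rot2, rot1] at *
        have hsq := Real.sq_sqrt hD.le
        have hsp := Real.sqrt_pos.2 hD
        have hsum := hval.sum_le (h.faceCond _) ξ
        generalize B.data (v + s • ξ) = d at *
        rw [← mul_div_assoc, ← mul_div_assoc, ← mul_div_assoc, ← add_div, ← add_div,
          div_le_iff₀ hsp]
        nth_rewrite 1 [← hsq] at hsum
        nth_rewrite 2 [← hsq] at hsum
        nth_rewrite 3 [← hsq] at hsum
        have m₁ := mul_nonneg (mul_nonneg hC₁ hnn) hsp.le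
        have m₂ := mul_nonneg (mul_nonneg hC₂ hnn) hsp.le
        have m₃ := mul_nonneg (mul_nonneg hC₃ hnn) hsp.le
        rcases hsum with hsum | hsum | hsum
        · nlinarith [mul_le_mul_of_nonneg_right b₁ hsp.le]
        · nlinarith [mul_le_mul_of_nonneg_right b₂ hsp.le]
        · nlinarith [mul_le_mul_of_nonneg_right b₃ hsp.le]
      · exfalso
        apply hsS
        have deg : ∀ {l m o : Fin N}, 0 < (B.data (v + s • ξ)).z l m →
            0 < (B.data (v + s • ξ)).z l o → ¬ 0 < (B.data (v + s • ξ)).disc l m o →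
            B.angle (v + s • ξ) l m o ∈ A := by
          intro l m o hz hw hd
          have : B.angle (v + s • ξ) l m o = 0 ∨ B.angle (v + s • ξ) l m o = π := by
            apply arccos_eq_zero_or_pi
            rw [div_pow, mul_pow, Real.sq_sqrt hz.le, Real.sq_sqrt hw.le,
              one_le_div (mul_pos hz hw)]
            unfold ConformalData.disc at hd
            linarith
          simpa [A] using this
        refine Finset.mem_image.2 ⟨(B.angle (v + s • ξ) i j k, B.angle (v + s • ξ) j k i,
          B.angle (v + s • ξ) k i j), ?_, rfl⟩
        simp only [Finset.mem_product]
        exact ⟨deg (zij _ hsD) (zik _ hsD) hD, deg (zjk _ hsD) (zji _ hsD) (by rwa [rot1]),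
          deg (zki _ hsD) (zkj _ hsD) (by rwa [rot2, rot1])⟩
  have e1 : v + (1 : ℝ) • ξ = u := by rw [hξ]; simp
  have e0 : v + (0 : ℝ) • ξ = v := by simp
  simp only [g, e1, e0] at key
  change ξ i * _ + ξ j * _ + ξ k * _ ≤ _
  linarith

theorem angle_comm {u : Fin N → ℝ} (hu : u ∈ B.Dom) (i j k : Fin N) :
    B.angle u i j k = B.angle u i k j := by
  rw [angle, angle, (valid hu).n_comm i j k, mul_comm √((B.data u).z i j)]

end Background

theorem abs_exp_sub_one_le_mul (x : ℝ) : |exp x - 1| ≤ |x| * exp |x| := by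
  have h1 := add_one_le_exp x
  have h2 := add_one_le_exp (-x)
  have h3 : exp x * exp (-x) = 1 := by rw [← exp_add]; simp
  have hp := exp_pos x
  have h4 : exp x ≤ exp |x| := exp_le_exp.2 (le_abs_self x)
  have h5 : 1 ≤ exp |x| := one_le_exp (abs_nonneg x)
  rw [abs_le]
  constructor
  · nlinarith [neg_abs_le x, abs_nonneg x]
  · have : exp x - 1 ≤ x * exp x := by nlinarith
    nlinarith [le_abs_self x, abs_nonneg x, mul_le_mul_of_nonneg_right (le_abs_self x) hp.le]

theorem sq_norm_le_sum_sq {N : ℕ} (v : Fin N → ℝ) : ‖v‖ ^ 2 ≤ ∑ i, v i ^ 2 := by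
  have h0 : 0 ≤ ∑ i, v i ^ 2 := Finset.sum_nonneg fun i _ => sq_nonneg _
  refine (Real.le_sqrt (norm_nonneg v) h0).1 ?_
  refine (pi_norm_le_iff_of_nonneg (Real.sqrt_nonneg _)).2 fun i => ?_
  exact Real.abs_le_sqrt (Finset.single_le_sum (f := fun i => v i ^ 2) (fun i _ => sq_nonneg _)
    (Finset.mem_univ i))

/-- Uniqueness for the flow `du/dt = Rbar - K e^{-α u}` under a one-sided Lipschitz estimate
on `K`. -/
theorem flow_unique {N : ℕ} {α T κ : ℝ} {Rbar : Fin N → ℝ} {uA uB KA KB : ℝ → Fin N → ℝ}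
    (hKA : ∀ t i, |KA t i| ≤ κ) (hKB : ∀ t i, |KB t i| ≤ κ)
    (hA : ∀ t ∈ Set.Ico (0 : ℝ) T, ∀ i, HasDerivWithinAt (fun s => uA s i)
      (Rbar i - KA t i * exp (-(α * uA t i))) (Set.Ico (0 : ℝ) T) t)
    (hB : ∀ t ∈ Set.Ico (0 : ℝ) T, ∀ i, HasDerivWithinAt (fun s => uB s i)
      (Rbar i - KB t i * exp (-(α * uB t i))) (Set.Ico (0 : ℝ) T) t)
    (hone : ∀ b ∈ Set.Ico (0 : ℝ) T, ∃ C, 0 ≤ C ∧ ∀ t ∈ Set.Icc 0 b,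
      ∑ i, (uA t i - uB t i) * (KB t i - KA t i) ≤ C * ‖uA t - uB t‖ ^ 2)
    (h0 : uA 0 = uB 0) : ∀ t ∈ Set.Ico (0 : ℝ) T, uA t = uB t := by
  intro b hb
  obtain ⟨C, hC, hone⟩ := hone b hb
  have hsub : Set.Icc 0 b ⊆ Set.Ico 0 T := fun s hs => ⟨hs.1, hs.2.trans_lt hb.2⟩
  have cA : ContinuousOn uA (Set.Icc 0 b) := continuousOn_pi.2 fun i s hs =>
    (hA s (hsub hs) i).continuousWithinAt.mono hsub
  have cB : ContinuousOn uB (Set.Icc 0 b) := continuousOn_pi.2 fun i s hs =>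
    (hB s (hsub hs) i).continuousWithinAt.mono hsub
  obtain ⟨MA, hMA⟩ := isCompact_Icc.exists_bound_of_continuousOn cA
  obtain ⟨MB, hMB⟩ := isCompact_Icc.exists_bound_of_continuousOn cB
  set M := max MA MB
  have bA : ∀ t ∈ Set.Icc 0 b, ∀ i, |uA t i| ≤ M := fun t ht i =>
    (norm_le_pi_norm (uA t) i).trans ((hMA t ht).trans (le_max_left _ _))
  have bB : ∀ t ∈ Set.Icc 0 b, ∀ i, |uB t i| ≤ M := fun t ht i =>
    (norm_le_pi_norm (uB t) i).trans ((hMB t ht).trans (le_max_right _ _))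
  set P := exp (|α| * M)
  set E := exp (|α| * (2 * M))
  set ρ := ∑ i, |Rbar i|
  set L := |α| * (ρ * P + |κ|) + 2 * C + 2 * |κ| * (|α| * E)
  have hρ : 0 ≤ ρ := Finset.sum_nonneg fun i _ => abs_nonneg _
  have hP : 0 < P := exp_pos _
  have hE : 0 < E := exp_pos _
  have hL : 0 ≤ L := by positivity
  let Φ : ℝ → ℝ := fun t => ∑ i, exp (α * uA t i) * (uA t i - uB t i) ^ 2
  let Ψ : ℝ → ℝ := fun t => exp (-(L * P) * t) * Φ t
  have cAi : ∀ i, ContinuousOn (fun t => uA t i) (Set.Icc 0 b) := fun i => continuousOn_pi.1 cA i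
  have cBi : ∀ i, ContinuousOn (fun t => uB t i) (Set.Icc 0 b) := fun i => continuousOn_pi.1 cB i
  have hΦc : ContinuousOn Φ (Set.Icc 0 b) :=
    continuousOn_finsetSum _ fun i _ => by
      have := cAi i
      have := cBi i
      fun_prop
  have hΨc : ContinuousOn Ψ (Set.Icc 0 b) := by
    have : ContinuousOn (fun t => exp (-(L * P) * t)) (Set.Icc 0 b) := by fun_prop
    exact this.mul hΦc
  have hderiv : ∀ t ∈ interior (Set.Icc 0 b), ∃ Ψ', HasDerivAt Ψ Ψ' t ∧ Ψ' ≤ 0 := by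
    intro t ht
    rw [interior_Icc] at ht
    have htI : t ∈ Set.Icc 0 b := Set.Ioo_subset_Icc_self ht
    have hnhds : Set.Ico 0 T ∈ nhds t := Ico_mem_nhds ht.1 (ht.2.trans hb.2)
    have dA := fun i => (hA t (hsub htI) i).hasDerivAt hnhds
    have dB := fun i => (hB t (hsub htI) i).hasDerivAt hnhds
    have dΦ : HasDerivAt Φ (∑ i, (exp (α * uA t i) * (α * (Rbar i - KA t i * exp (-(α * uA t i)))) *
        (uA t i - uB t i) ^ 2 + exp (α * uA t i) * (2 * (uA t i - uB t i) *
        ((Rbar i - KA t i * exp (-(α * uA t i))) - (Rbar i - KB t i * exp (-(α * uB t i))))))) t :=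
      HasDerivAt.fun_sum fun i _ =>
        (((dA i).const_mul α).exp.mul (((dA i).sub (dB i)).pow 2)).congr_deriv (by simp)
    have dexp : HasDerivAt (fun t => exp (-(L * P) * t)) (exp (-(L * P) * t) * -(L * P)) t :=
      ((hasDerivAt_id t).const_mul (-(L * P))).exp.congr_deriv (by simp)
    refine ⟨_, dexp.mul dΦ, ?_⟩
    have hS : Φ t * P ≥ ∑ i, (uA t i - uB t i) ^ 2 := by
      simp only [Φ, Finset.sum_mul, ge_iff_le]
      refine Finset.sum_le_sum fun i _ => ?_
      have : 1 ≤ exp (α * uA t i) * P := by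
        rw [← exp_add]
        refine one_le_exp ?_
        have h1 := neg_abs_le (α * uA t i)
        rw [abs_mul] at h1
        have := mul_le_mul_of_nonneg_left (bA t htI i) (abs_nonneg α)
        linarith
      nlinarith [sq_nonneg (uA t i - uB t i)]
    have hsum := hone t htI
    have hnorm := sq_norm_le_sum_sq (uA t - uB t)
    simp only [Pi.sub_apply] at hnorm
    have hle : ∑ i, (exp (α * uA t i) * (α * (Rbar i - KA t i * exp (-(α * uA t i)))) *
        (uA t i - uB t i) ^ 2 + exp (α * uA t i) * (2 * (uA t i - uB t i) *
        ((Rbar i - KA t i * exp (-(α * uA t i))) - (Rbar i - KB t i * exp (-(α * uB t i)))))) ≤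
        L * ∑ i, (uA t i - uB t i) ^ 2 := by
      have hi : ∀ i, exp (α * uA t i) * (α * (Rbar i - KA t i * exp (-(α * uA t i)))) *
        (uA t i - uB t i) ^ 2 + exp (α * uA t i) * (2 * (uA t i - uB t i) *
        ((Rbar i - KA t i * exp (-(α * uA t i))) - (Rbar i - KB t i * exp (-(α * uB t i))))) ≤
        (|α| * (ρ * P + |κ|) + 2 * |κ| * (|α| * E)) * (uA t i - uB t i) ^ 2 +
          2 * ((uA t i - uB t i) * (KB t i - KA t i)) := by
        intro i
        have x1 : exp (α * uA t i) * exp (-(α * uA t i)) = 1 := by rw [← exp_add]; simp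
        have x2 : exp (α * uA t i) * exp (-(α * uB t i)) = exp (α * (uA t i - uB t i)) := by
          rw [← exp_add]; congr 1; ring
        have xP : exp (α * uA t i) ≤ P := by
          refine exp_le_exp.2 ((le_abs_self _).trans ?_)
          rw [abs_mul]
          exact mul_le_mul_of_nonneg_left (bA t htI i) (abs_nonneg α)
        have hκ : |KA t i| ≤ |κ| := (hKA t i).trans (le_abs_self κ)
        have hκ' : |KB t i| ≤ |κ| := (hKB t i).trans (le_abs_self κ)
        have hR : |Rbar i| ≤ ρ :=
          Finset.single_le_sum (f := fun i => |Rbar i|) (fun i _ => abs_nonneg _)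
            (Finset.mem_univ i)
        have q1 : α * (Rbar i * exp (α * uA t i) - KA t i) ≤ |α| * (ρ * P + |κ|) := by
          refine (le_abs_self _).trans ?_
          rw [abs_mul]
          refine mul_le_mul_of_nonneg_left ((abs_sub _ _).trans (add_le_add ?_ hκ)) (abs_nonneg α)
          rw [abs_mul, abs_of_pos (exp_pos _)]
          exact mul_le_mul hR xP (exp_pos _).le hρ
        have q2 : (uA t i - uB t i) * (KB t i * (exp (α * (uA t i - uB t i)) - 1)) ≤
            |κ| * (|α| * E) * (uA t i - uB t i) ^ 2 := by
          refine (le_abs_self _).trans ?_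
          have e1 := abs_exp_sub_one_le_mul (α * (uA t i - uB t i))
          have e2 : exp |α * (uA t i - uB t i)| ≤ E := by
            refine exp_le_exp.2 ?_
            rw [abs_mul]
            refine mul_le_mul_of_nonneg_left ?_ (abs_nonneg α)
            exact (abs_sub _ _).trans (by linarith [bA t htI i, bB t htI i])
          have e3 : |exp (α * (uA t i - uB t i)) - 1| ≤ |α| * |uA t i - uB t i| * E := by
            rw [← abs_mul]
            exact e1.trans (mul_le_mul_of_nonneg_left e2 (abs_nonneg _))
          rw [abs_mul, abs_mul, ← sq_abs (uA t i - uB t i)]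
          calc _ ≤ |uA t i - uB t i| * (|κ| * (|α| * |uA t i - uB t i| * E)) := by gcongr
            _ = _ := by ring
        have q3 := mul_le_mul_of_nonneg_right q1 (sq_nonneg (uA t i - uB t i))
        have expand : exp (α * uA t i) * (α * (Rbar i - KA t i * exp (-(α * uA t i)))) *
          (uA t i - uB t i) ^ 2 + exp (α * uA t i) * (2 * (uA t i - uB t i) *
          ((Rbar i - KA t i * exp (-(α * uA t i))) - (Rbar i - KB t i * exp (-(α * uB t i))))) =
          α * (Rbar i * exp (α * uA t i) - KA t i) * (uA t i - uB t i) ^ 2 +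
          2 * ((uA t i - uB t i) * (KB t i * (exp (α * (uA t i - uB t i)) - 1))) +
          2 * ((uA t i - uB t i) * (KB t i - KA t i)) := by
          linear_combination (- α * KA t i * (uA t i - uB t i) ^ 2 -
            2 * (uA t i - uB t i) * KA t i) * x1 + 2 * (uA t i - uB t i) * KB t i * x2
        rw [expand]
        linarith
      refine (Finset.sum_le_sum fun i _ => hi i).trans ?_
      rw [Finset.sum_add_distrib, ← Finset.mul_sum, ← Finset.mul_sum]
      have := mul_le_mul_of_nonneg_left hnorm hC
      simp only [L]
      linarith
    have hfin := hle.trans (mul_le_mul_of_nonneg_left hS hL)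
    have hexp := exp_pos (-(L * P) * t)
    have := mul_le_mul_of_nonneg_left hfin hexp.le
    linarith
  have hanti : AntitoneOn Ψ (Set.Icc 0 b) := by
    refine antitoneOn_of_deriv_nonpos (convex_Icc 0 b) hΨc ?_ ?_
    · intro t ht
      obtain ⟨_, h, -⟩ := hderiv t ht
      exact h.differentiableAt.differentiableWithinAt
    · intro t ht
      obtain ⟨_, h, h'⟩ := hderiv t ht
      rwa [h.deriv]
  have hle := hanti (Set.left_mem_Icc.2 hb.1) (Set.right_mem_Icc.2 hb.1) hb.1
  have hΨ0 : Ψ 0 = 0 := by simp [Ψ, Φ, h0]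
  rw [hΨ0] at hle
  have hΦ0 : Φ b ≤ 0 := nonpos_of_mul_nonpos_right hle (exp_pos _)
  have hterm : ∀ i, 0 ≤ exp (α * uA b i) * (uA b i - uB b i) ^ 2 := fun i => by positivity
  have hz := (Finset.sum_eq_zero_iff_of_nonneg fun i _ => hterm i).1
    (le_antisymm hΦ0 (Finset.sum_nonneg fun i _ => hterm i))
  funext i
  have := hz i (Finset.mem_univ i)
  have h2 := (mul_eq_zero.1 this).resolve_left (exp_pos _).ne'
  exact sub_eq_zero.1 (pow_eq_zero_iff two_ne_zero |>.1 h2)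

namespace TriSurface

variable {N : ℕ}

/-- The angle at `i` in the face `σ`, for angles prescribed by `θ`. -/
noncomputable def faceAngle (θ : Fin N → Fin N → Fin N → ℝ) (i : Fin N) (σ : Finset (Fin N)) : ℝ :=
  (1 / 2) * ∑ j ∈ σ.erase i, ∑ k ∈ (σ.erase i).erase j, θ i j k

/-- The curvature at `i` for angles prescribed by `θ`. -/
noncomputable def curv (S : TriSurface N) (θ : Fin N → Fin N → Fin N → ℝ) (i : Fin N) : ℝ :=
  2 * π - ∑ σ ∈ S.F.filter (fun σ => i ∈ σ), faceAngle θ i σ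

theorem faceAngle_triple (θ : Fin N → Fin N → Fin N → ℝ) {i j k : Fin N} (hij : i ≠ j)
    (hik : i ≠ k) (hjk : j ≠ k) : faceAngle θ i {i, j, k} = (θ i j k + θ i k j) / 2 := by
  have h1 : ({i, j, k} : Finset (Fin N)).erase i = {j, k} := by
    ext x; simp only [Finset.mem_erase, Finset.mem_insert, Finset.mem_singleton]; grind
  have h2 : ({j, k} : Finset (Fin N)).erase j = {k} := by
    ext x; simp only [Finset.mem_erase, Finset.mem_insert, Finset.mem_singleton]; grind
  have h3 : ({j, k} : Finset (Fin N)).erase k = {j} := by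
    ext x; simp only [Finset.mem_erase, Finset.mem_insert, Finset.mem_singleton]; grind
  rw [faceAngle, h1, Finset.sum_pair hjk, h2, h3, Finset.sum_singleton, Finset.sum_singleton]
  ring

theorem faceAngle_congr {θ θ' : Fin N → Fin N → Fin N → ℝ} {σ : Finset (Fin N)} (hσ : σ.card = 3)
    {i : Fin N} (hi : i ∈ σ)
    (h : ∀ i j k, i ≠ j → i ≠ k → j ≠ k → σ = {i, j, k} → θ i j k = θ' i j k) :
    faceAngle θ i σ = faceAngle θ' i σ := by
  obtain ⟨j, k, hjk, hσi⟩ := Finset.card_eq_two.1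
    (show (σ.erase i).card = 2 by rw [Finset.card_erase_of_mem hi, hσ])
  have hσ' : σ = {i, j, k} := by rw [← Finset.insert_erase hi, hσi]
  have hj : j ∈ σ.erase i := by simp [hσi]
  have hk : k ∈ σ.erase i := by simp [hσi]
  have hij := (Finset.ne_of_mem_erase hj).symm
  have hik := (Finset.ne_of_mem_erase hk).symm
  have hσ'' : σ = {i, k, j} := by rw [hσ', Finset.pair_comm]
  have h1 := h i j k hij hik hjk hσ'
  have h2 := h i k j hik hij hjk.symm hσ''
  rw [hσ', faceAngle_triple θ hij hik hjk, faceAngle_triple θ' hij hik hjk, h1, h2]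

theorem curv_congr (S : TriSurface N) {θ θ' : Fin N → Fin N → Fin N → ℝ}
    (h : ∀ i j k, i ≠ j → i ≠ k → j ≠ k → {i, j, k} ∈ S.F → θ i j k = θ' i j k) (i : Fin N) :
    S.curv θ i = S.curv θ' i := by
  unfold curv
  congr 1
  refine Finset.sum_congr rfl fun σ hσ => ?_
  rw [Finset.mem_filter] at hσ
  exact faceAngle_congr (S.card_face σ hσ.1) hσ.2
    fun i j k h1 h2 h3 hs => h i j k h1 h2 h3 (hs ▸ hσ.1)

theorem exists_abs_curv_le (S : TriSurface N) :
    ∃ κ, ∀ θ : Fin N → Fin N → Fin N → ℝ, (∀ i j k, 0 ≤ θ i j k ∧ θ i j k ≤ π) →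
      ∀ i, |S.curv θ i| ≤ κ := by
  let A : Fin N → ℝ := fun i => ∑ σ ∈ S.F.filter (fun σ => i ∈ σ), faceAngle (fun _ _ _ => π) i σ
  have nonneg : ∀ (θ : Fin N → Fin N → Fin N → ℝ), (∀ i j k, 0 ≤ θ i j k) → ∀ i σ,
      0 ≤ faceAngle θ i σ := fun θ hθ i σ =>
    mul_nonneg (by norm_num) (Finset.sum_nonneg fun j _ => Finset.sum_nonneg fun k _ => hθ i j k)
  have A_nonneg : ∀ i, 0 ≤ A i := fun i =>
    Finset.sum_nonneg fun σ _ => nonneg _ (fun _ _ _ => pi_pos.le) i σ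
  refine ⟨2 * π + ∑ i, A i, fun θ hθ i => ?_⟩
  have h1 : 0 ≤ ∑ σ ∈ S.F.filter (fun σ => i ∈ σ), faceAngle θ i σ :=
    Finset.sum_nonneg fun σ _ => nonneg θ (fun i j k => (hθ i j k).1) i σ
  have h2 : ∑ σ ∈ S.F.filter (fun σ => i ∈ σ), faceAngle θ i σ ≤ A i :=
    Finset.sum_le_sum fun σ _ => mul_le_mul_of_nonneg_left
      (Finset.sum_le_sum fun j _ => Finset.sum_le_sum fun k _ => (hθ i j k).2) (by norm_num)
  have h3 : A i ≤ ∑ i, A i := Finset.single_le_sum (fun i _ => A_nonneg i) (Finset.mem_univ i)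
  have := pi_pos
  rw [curv, abs_le]
  constructor <;> linarith

theorem sum_mul_curv_sub (S : TriSurface N) (ξ : Fin N → ℝ) (θ θ' : Fin N → Fin N → Fin N → ℝ) :
    ∑ i, ξ i * (S.curv θ' i - S.curv θ i) =
      ∑ σ ∈ S.F, ∑ i ∈ σ, ξ i * (faceAngle θ i σ - faceAngle θ' i σ) := by
  simp only [curv, sub_sub_sub_cancel_left, ← Finset.sum_sub_distrib, Finset.mul_sum]
  refine Finset.sum_comm' fun i σ => ?_
  simp [and_comm]

/-- The discrete conformal structure `B` is defined on the triangulated surface `S`. -/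
def Compatible (S : TriSurface N) (B : Background N) : Prop :=
  ∀ i j k, i ≠ j → i ≠ k → j ≠ k → {i, j, k} ∈ S.F → B.Face i j k

/-- The extended curvatures satisfy a one-sided Lipschitz estimate on compact convex sets. -/
theorem Compatible.curv_one_sided {S : TriSurface N} {B : Background N} (h : S.Compatible B)
    {K : Set (Fin N → ℝ)} (hK : IsCompact K) (hKc : Convex ℝ K) (hKD : K ⊆ B.Dom) :
    ∃ C, 0 ≤ C ∧ ∀ u ∈ K, ∀ v ∈ K,
      ∑ i, (u i - v i) * (S.curv (B.angle v) i - S.curv (B.angle u) i) ≤ C * ‖u - v‖ ^ 2 := by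
  have hface : ∀ σ ∈ S.F, ∃ C, 0 ≤ C ∧ ∀ u ∈ K, ∀ v ∈ K,
      ∑ i ∈ σ, (u i - v i) * (faceAngle (B.angle u) i σ - faceAngle (B.angle v) i σ) ≤
        C * ‖u - v‖ ^ 2 := by
    intro σ hσ
    obtain ⟨a, b, c, hab, hac, hbc, rfl⟩ := Finset.card_eq_three.1 (S.card_face σ hσ)
    obtain ⟨C, hC, hle⟩ := (h a b c hab hac hbc hσ).exists_one_sided hK hKc hKD
    refine ⟨C, hC, fun u hu v hv => ?_⟩
    have hcyc : ({a, b, c} : Finset (Fin N)) = {b, c, a} := by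
      ext x; simp only [Finset.mem_insert, Finset.mem_singleton]; tauto
    have hcyc' : ({a, b, c} : Finset (Fin N)) = {c, a, b} := by
      ext x; simp only [Finset.mem_insert, Finset.mem_singleton]; tauto
    have hA : ∀ w ∈ K, faceAngle (B.angle w) a {a, b, c} = B.angle w a b c ∧
        faceAngle (B.angle w) b {a, b, c} = B.angle w b c a ∧
        faceAngle (B.angle w) c {a, b, c} = B.angle w c a b := by
      intro w hw
      refine ⟨?_, ?_, ?_⟩
      · rw [faceAngle_triple _ hab hac hbc, Background.angle_comm (hKD hw) a c b]; ring
      · rw [hcyc, faceAngle_triple _ hbc hab.symm hac.symm, Background.angle_comm (hKD hw) b a c]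
        ring
      · rw [hcyc', faceAngle_triple _ hac.symm hbc.symm hab, Background.angle_comm (hKD hw) c b a]
        ring
    obtain ⟨u1, u2, u3⟩ := hA u hu
    obtain ⟨v1, v2, v3⟩ := hA v hv
    rw [Finset.sum_insert (by simp [hab, hac]), Finset.sum_pair hbc, u1, u2, u3, v1, v2, v3,
      ← add_assoc]
    exact hle u hu v hv
  choose! C hC hle using hface
  refine ⟨∑ σ ∈ S.F, C σ, Finset.sum_nonneg hC, fun u hu v hv => ?_⟩
  rw [S.sum_mul_curv_sub fun i => u i - v i, Finset.sum_mul]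
  exact Finset.sum_le_sum fun σ hσ => hle σ hσ u hu v hv

/-- Two solutions of the modified `α`-flow of a discrete conformal structure which start at the
same point coincide. -/
theorem Compatible.flow_unique {S : TriSurface N} {B : Background N} (h : S.Compatible B)
    {α T : ℝ} {Rbar : Fin N → ℝ} {uA uB : ℝ → Fin N → ℝ}
    (domA : ∀ t, uA t ∈ B.Dom) (domB : ∀ t, uB t ∈ B.Dom)
    (hA : ∀ t ∈ Set.Ico (0 : ℝ) T, ∀ i, HasDerivWithinAt (fun s => uA s i)
      (Rbar i - S.curv (B.angle (uA t)) i * exp (-(α * uA t i))) (Set.Ico (0 : ℝ) T) t)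
    (hB : ∀ t ∈ Set.Ico (0 : ℝ) T, ∀ i, HasDerivWithinAt (fun s => uB s i)
      (Rbar i - S.curv (B.angle (uB t)) i * exp (-(α * uB t i))) (Set.Ico (0 : ℝ) T) t)
    (h0 : uA 0 = uB 0) : ∀ t ∈ Set.Ico (0 : ℝ) T, uA t = uB t := by
  obtain ⟨κ, hκ⟩ := S.exists_abs_curv_le
  have hbound : ∀ u i, |S.curv (B.angle u) i| ≤ κ := fun u i =>
    hκ _ (fun _ _ _ => ⟨arccos_nonneg _, arccos_le_pi _⟩) i
  refine _root_.flow_unique (KA := fun t => S.curv (B.angle (uA t)))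
    (KB := fun t => S.curv (B.angle (uB t))) (fun t => hbound _) (fun t => hbound _) hA hB
    (fun b hb => ?_) h0
  have hsub : Set.Icc 0 b ⊆ Set.Ico 0 T := fun s hs => ⟨hs.1, hs.2.trans_lt hb.2⟩
  have cA : ContinuousOn uA (Set.Icc 0 b) := continuousOn_pi.2 fun i s hs =>
    (hA s (hsub hs) i).continuousWithinAt.mono hsub
  have cB : ContinuousOn uB (Set.Icc 0 b) := continuousOn_pi.2 fun i s hs =>
    (hB s (hsub hs) i).continuousWithinAt.mono hsub
  let V : Fin N → Set ℝ := fun i =>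
    (fun t => uA t i) '' Set.Icc 0 b ∪ (fun t => uB t i) '' Set.Icc 0 b
  have hV : ∀ i, IsCompact (V i) := fun i =>
    (isCompact_Icc.image_of_continuousOn (continuousOn_pi.1 cA i)).union
      (isCompact_Icc.image_of_continuousOn (continuousOn_pi.1 cB i))
  have hVne : ∀ i, (V i).Nonempty := fun i => ⟨_, Or.inl ⟨0, Set.left_mem_Icc.2 hb.1, rfl⟩⟩
  have hVdom : ∀ i, V i ⊆ B.dom i := by
    rintro i _ (⟨t, -, rfl⟩ | ⟨t, -, rfl⟩)
    exacts [domA t i, domB t i]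
  choose p hp using fun i => (hV i).exists_isLeast (hVne i)
  choose q hq using fun i => (hV i).exists_isGreatest (hVne i)
  have hKD : Set.Icc p q ⊆ B.Dom := fun u hu i =>
    (B.dom_convex i).ordConnected.out (hVdom i (hp i).1) (hVdom i (hq i).1) ⟨hu.1 i, hu.2 i⟩
  obtain ⟨C, hC, hle⟩ := h.curv_one_sided isCompact_Icc (convex_Icc p q) hKD
  have mem : ∀ u : Fin N → ℝ, (∀ i, u i ∈ V i) → u ∈ Set.Icc p q := fun u hu =>
    ⟨fun i => (hp i).2 (hu i), fun i => (hq i).2 (hu i)⟩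
  exact ⟨C, hC, fun t ht => hle _ (mem _ fun i => Or.inl ⟨t, ht, rfl⟩) _
    (mem _ fun i => Or.inr ⟨t, ht, rfl⟩)⟩

end TriSurface

namespace TriSurface

variable {N : ℕ} {S : TriSurface N}

theorem mem_edges_of_mem_F {σ e : Finset (Fin N)} (hσ : σ ∈ S.F) (he : e ⊆ σ) (hc : e.card = 2) :
    e ∈ S.edges :=
  Finset.mem_biUnion.2 ⟨σ, hσ, Finset.mem_powersetCard.2 ⟨he, hc⟩⟩

theorem Weights.compatible (W : Weights S) (B : Background N) (heps : B.eps = W.eps)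
    (heta : B.eta = W.eta) : S.Compatible B := by
  intro i j k hij hik hjk hF
  have h₁ : ({j, i, k} : Finset (Fin N)) ∈ S.F := by rwa [Finset.insert_comm]
  have h₂ : ({k, i, j} : Finset (Fin N)) ∈ S.F := by
    rwa [Finset.insert_comm, Finset.pair_comm k j]
  have edge : ∀ a b, a ≠ b → ({a, b} : Finset (Fin N)) ⊆ {i, j, k} →
      0 < W.eps a * W.eps b + W.eta a b := fun a b hab hs =>
    W.structCond1 a b (mem_edges_of_mem_F hF hs (Finset.card_pair hab))
  have f₁ := W.structCond2 i j k hF hij hik hjk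
  have f₂ := W.structCond2 j i k h₁ hij.symm hjk hik
  have f₃ := W.structCond2 k i j h₂ hik.symm hjk.symm hij
  rw [W.eta_symm j i] at f₂
  rw [W.eta_symm k i, W.eta_symm k j] at f₃
  rw [Background.Face, heps, heta]
  exact ⟨edge i j hij (by grind), edge i k hik (by grind), edge j k hjk (by grind), f₁, f₂, f₃⟩

/-- The Euclidean background with the weights `W`. -/
noncomputable def Weights.euclidean (W : Weights S) : Background N where
  lam := 0
  eps := W.eps
  eta := W.eta
  X _ := exp
  C _ _ := 1
  dom _ := Set.univ
  lam01 := Or.inl rfl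
  eps01 := W.eps01
  eta_symm := W.eta_symm
  dom_convex _ := convex_univ
  X_pos _ _ _ := exp_pos _
  C_pos _ _ _ := one_pos
  C_sq _ _ _ := by simp
  X_deriv _ u _ := by simpa using hasDerivAt_exp u
  C_deriv _ u _ := by simpa using hasDerivAt_const u (1 : ℝ)

/-- The hyperbolic background with the weights `W`. -/
noncomputable def Weights.hyperbolic (W : Weights S) : Background N where
  lam := 1
  eps := W.eps
  eta := W.eta
  X i u := if W.eps i = 0 then exp u else -(sinh u)⁻¹
  C i u := if W.eps i = 0 then 1 else -(cosh u / sinh u)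
  dom i := if W.eps i = 0 then Set.univ else Set.Iio 0
  lam01 := Or.inr rfl
  eps01 := W.eps01
  eta_symm := W.eta_symm
  dom_convex i := by
    split_ifs
    exacts [convex_univ, convex_Iio 0]
  X_pos i u hu := by
    split_ifs at hu ⊢
    · exact exp_pos u
    · exact neg_pos.2 (inv_lt_zero.2 (sinh_neg_iff.2 hu))
  C_pos i u hu := by
    split_ifs at hu ⊢
    · exact one_pos
    · exact neg_pos.2 (div_neg_of_pos_of_neg (cosh_pos u) (sinh_neg_iff.2 hu))
  C_sq i u hu := by
    split_ifs at hu ⊢ with h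
    · simp [h]
    · have hs : sinh u ≠ 0 := (sinh_neg_iff.2 hu).ne
      rw [(W.eps01 i).resolve_left h]
      field_simp
      rw [cosh_sq]
  X_deriv i u hu := by
    split_ifs at hu ⊢ with h
    · simpa [h] using hasDerivAt_exp u
    · have hs : sinh u ≠ 0 := (sinh_neg_iff.2 hu).ne
      refine ((hasDerivAt_sinh u).inv hs).neg.congr_deriv ?_
      field_simp
  C_deriv i u hu := by
    split_ifs at hu ⊢ with h
    · simpa [h] using hasDerivAt_const u (1 : ℝ)
    · have hs : sinh u ≠ 0 := (sinh_neg_iff.2 hu).ne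
      refine ((hasDerivAt_cosh u).div (hasDerivAt_sinh u) hs).neg.congr_deriv ?_
      rw [(W.eps01 i).resolve_left h]
      field_simp
      rw [cosh_sq]
      ring

/-- The law of cosines for the generalized Euclidean angle of a triple of positive lengths. -/
theorem arccos_euclidean_eq {a b c : ℝ} (ha : 0 < a) (hb : 0 < b) (hc : 0 < c) :
    (if a + b > c ∧ a + c > b ∧ b + c > a then arccos ((a ^ 2 + b ^ 2 - c ^ 2) / (2 * a * b))
      else if c ≥ a + b then π else 0) = arccos ((a ^ 2 + b ^ 2 - c ^ 2) / (2 * a * b)) := by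
  have hab : 0 < 2 * a * b := by positivity
  split_ifs with h₁ h₂
  · rfl
  · refine (arccos_eq_pi.2 ?_).symm
    rw [div_le_iff₀ hab]
    nlinarith
  · refine (arccos_eq_zero.2 ?_).symm
    rw [le_div_iff₀ hab]
    rcases le_or_gt (a + c) b with h | h
    · nlinarith
    · have : b + c ≤ a := by
        by_contra hlt
        exact h₁ ⟨not_le.1 h₂, h, not_le.1 hlt⟩
      nlinarith

/-- The law of cosines for the generalized hyperbolic angle of a triple of positive lengths. -/
theorem arccos_hyperbolic_eq {a b c : ℝ} (ha : 0 < a) (hb : 0 < b) (hc : 0 < c) :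
    (if a + b > c ∧ a + c > b ∧ b + c > a then
        arccos ((cosh a * cosh b - cosh c) / (sinh a * sinh b))
      else if c ≥ a + b then π else 0) =
      arccos ((cosh a * cosh b - cosh c) / (sinh a * sinh b)) := by
  have hab : 0 < sinh a * sinh b := mul_pos (sinh_pos_iff.2 ha) (sinh_pos_iff.2 hb)
  split_ifs with h₁ h₂
  · rfl
  · refine (arccos_eq_pi.2 ?_).symm
    rw [div_le_iff₀ hab]
    have := cosh_le_cosh.2 (show |a + b| ≤ |c| by
      rwa [abs_of_pos (add_pos ha hb), abs_of_pos hc])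
    rw [cosh_add] at this
    linarith
  · refine (arccos_eq_zero.2 ?_).symm
    rw [le_div_iff₀ hab]
    have hle : c ≤ |a - b| := by
      by_contra hlt
      obtain ⟨h₃, h₄⟩ := abs_lt.1 (not_le.1 hlt)
      exact h₁ ⟨not_le.1 h₂, by linarith, by linarith⟩
    have := cosh_le_cosh.2 (show |c| ≤ |a - b| by rwa [abs_of_pos hc])
    rw [cosh_sub] at this
    linarith

theorem lE_eq (W : Weights S) (u : Fin N → ℝ) (i j : Fin N) :
    lE W u i j = √((W.euclidean.data u).z i j) := by
  rw [lE]
  congr 1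
  simp only [ConformalData.z, ConformalData.y, Background.data, Weights.euclidean, exp_add, two_mul]
  ring

theorem thetaExE_eq_angle (W : Weights S) (u : Fin N → ℝ) {i j k : Fin N}
    (h : W.euclidean.Face i j k) : thetaExE W u i j k = W.euclidean.angle u i j k := by
  have hu : u ∈ W.euclidean.Dom := fun _ => Set.mem_univ _
  have hv := Background.valid hu
  have zij : 0 < (W.euclidean.data u).z i j := hv.z_pos h.1
  have zik : 0 < (W.euclidean.data u).z i k := hv.z_pos h.2.1
  have zjk : 0 < (W.euclidean.data u).z j k := hv.z_pos h.2.2.1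
  rw [thetaExE, thetaE, lE_eq, lE_eq, lE_eq,
    arccos_euclidean_eq (sqrt_pos.2 zij) (sqrt_pos.2 zik) (sqrt_pos.2 zjk),
    sq_sqrt zij.le, sq_sqrt zik.le, sq_sqrt zjk.le, Background.angle, mul_assoc, ← div_div]
  congr 2
  simp only [ConformalData.z, ConformalData.n, Background.data, Weights.euclidean]
  ring

/-- The hyperbolic coordinate `u` of a vertex of weight `1` solves `exp u ^ 2 * (w + 1) = w - 1`, where
`w = √(1 + exp (2 * x))`. -/
theorem ucoord_one_neg_and_exp_sq (x : ℝ) : ucoord 1 x < 0 ∧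
    exp (ucoord 1 x) ^ 2 * (√(1 + exp (2 * x)) + 1) = √(1 + exp (2 * x)) - 1 := by
  have hw : 1 < √(1 + exp (2 * x)) := by
    rw [Real.lt_sqrt zero_le_one]
    linarith [exp_pos (2 * x)]
  set w := √(1 + exp (2 * x))
  have hq : 0 < (w - 1) / (w + 1) := div_pos (by linarith) (by linarith)
  have hu : ucoord 1 x = 1 / 2 * log ((w - 1) / (w + 1)) := if_neg one_ne_zero
  constructor
  · have : log ((w - 1) / (w + 1)) < 0 :=
      log_neg hq ((div_lt_one (by linarith)).2 (by linarith))
    linarith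
  · have : exp (ucoord 1 x) ^ 2 = (w - 1) / (w + 1) := by
      rw [← exp_nat_mul, hu, ← mul_assoc]
      norm_num [exp_log hq]
    rw [this, div_mul_cancel₀ _ (by linarith)]

theorem ucoord_mem_dom (W : Weights S) (i : Fin N) (x : ℝ) :
    ucoord (W.eps i) x ∈ W.hyperbolic.dom i := by
  by_cases h : W.eps i = 0
  · simp [Weights.hyperbolic, h]
  · simpa [Weights.hyperbolic, (W.eps01 i).resolve_left h] using (ucoord_one_neg_and_exp_sq x).1

theorem hyperbolic_X_ucoord (W : Weights S) (i : Fin N) (x : ℝ) :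
    W.hyperbolic.X i (ucoord (W.eps i) x) = exp x := by
  have hpos := W.hyperbolic.X_pos i _ (ucoord_mem_dom W i x)
  rcases W.eps01 i with h | h
  · simp [Weights.hyperbolic, ucoord, h]
  refine (sq_eq_sq₀ hpos.le (exp_pos x).le).1 ?_
  obtain ⟨hu, hE⟩ := ucoord_one_neg_and_exp_sq x
  have hw : √(1 + exp (2 * x)) ^ 2 = 1 + exp x ^ 2 := by
    rw [sq_sqrt (by positivity), ← exp_nat_mul]; norm_num
  have hE0 := exp_pos (ucoord 1 x)
  simp only [Weights.hyperbolic, h, one_ne_zero, if_false]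
  rw [neg_sq, inv_pow, inv_eq_iff_eq_inv, ← one_div, eq_div_iff (by positivity), sinh_eq, exp_neg]
  generalize √(1 + exp (2 * x)) = w at *
  generalize exp (ucoord 1 x) = E at *
  have hy : exp x ^ 2 = E ^ 2 * (w + 1) ^ 2 := by linear_combination -hw - (w + 1) * hE
  have hk : (E ^ 2 - 1) * (w + 1) = -2 := by linear_combination hE
  rw [hy]
  field_simp
  linear_combination ((E ^ 2 - 1) * (w + 1) - 2) * hk

theorem hyperbolic_C_ucoord (W : Weights S) (i : Fin N) (x : ℝ) :
    W.hyperbolic.C i (ucoord (W.eps i) x) = √(1 + W.eps i * exp (2 * x)) := by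
  have hdom := ucoord_mem_dom W i x
  rw [eq_comm, sqrt_eq_iff_eq_sq _ (W.hyperbolic.C_pos i _ hdom).le, W.hyperbolic.C_sq i _ hdom,
    hyperbolic_X_ucoord, ← exp_nat_mul]
  · simp [Weights.hyperbolic]
  · rcases W.eps01 i with h | h <;> rw [h] <;> positivity

theorem uOf_mem_Dom (W : Weights S) (f : Fin N → ℝ) : uOf W f ∈ W.hyperbolic.Dom :=
  fun i => ucoord_mem_dom W i (f i)

theorem uOf_injective (W : Weights S) : Function.Injective (uOf W) := by
  intro f g h
  funext i
  have := congrArg (W.hyperbolic.X i) (congrFun h i)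
  simp only [uOf, hyperbolic_X_ucoord] at this
  exact exp_injective this

theorem lH_eq (W : Weights S) (f : Fin N → ℝ) (i j : Fin N) :
    lH W f i j = Real.arcosh (1 + (W.hyperbolic.data (uOf W f)).y i j) := by
  rw [lH, TriSurface.arcosh, Real.arcosh]
  have : 1 + (W.hyperbolic.data (uOf W f)).y i j =
      √((1 + W.eps i * exp (2 * f i)) * (1 + W.eps j * exp (2 * f j))) +
        W.eta i j * exp (f i + f j) := by
    simp only [ConformalData.y, Background.data, uOf, hyperbolic_X_ucoord, hyperbolic_C_ucoord]
    have h : 0 ≤ 1 + W.eps i * exp (2 * f i) := by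
      rcases W.eps01 i with h | h <;> rw [h] <;> positivity
    rw [sqrt_mul h, exp_add]
    simp only [Weights.hyperbolic]
    ring
  rw [this]

theorem thetaExH_eq_angle (W : Weights S) (f : Fin N → ℝ) {i j k : Fin N}
    (h : W.hyperbolic.Face i j k) :
    thetaExH W f i j k = W.hyperbolic.angle (uOf W f) i j k := by
  have hv := Background.valid (uOf_mem_Dom W f)
  have yij : 0 < (W.hyperbolic.data (uOf W f)).y i j := hv.y_pos h.1
  have yik : 0 < (W.hyperbolic.data (uOf W f)).y i k := hv.y_pos h.2.1
  have yjk : 0 < (W.hyperbolic.data (uOf W f)).y j k := hv.y_pos h.2.2.1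
  have sinh_eq : ∀ {a b : Fin N}, 0 < (W.hyperbolic.data (uOf W f)).y a b →
      sinh (Real.arcosh (1 + (W.hyperbolic.data (uOf W f)).y a b)) =
        √((W.hyperbolic.data (uOf W f)).z a b) := fun hy => by
    rw [Real.sinh_arcosh (by linarith), ConformalData.z]
    congr 1
    simp only [Background.data, Weights.hyperbolic]
    ring
  rw [thetaExH, thetaH, lH_eq, lH_eq, lH_eq,
    arccos_hyperbolic_eq (Real.arcosh_pos (by linarith)) (Real.arcosh_pos (by linarith))
      (Real.arcosh_pos (by linarith)),
    Real.cosh_arcosh (by linarith), Real.cosh_arcosh (by linarith), Real.cosh_arcosh (by linarith),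
    sinh_eq yij, sinh_eq yik, Background.angle]
  congr 2
  simp only [ConformalData.n, Background.data, Weights.hyperbolic]
  ring

theorem KExE_eq_curv (W : Weights S) (u : Fin N → ℝ) (i : Fin N) :
    KExE W u i = S.curv (W.euclidean.angle u) i := by
  have : KExE W u i = S.curv (thetaExE W u) i := rfl
  rw [this]
  exact S.curv_congr (fun a b c hab hac hbc hF =>
    thetaExE_eq_angle W u (W.compatible _ rfl rfl a b c hab hac hbc hF)) i

theorem KExH_eq_curv (W : Weights S) (f : Fin N → ℝ) (i : Fin N) :
    KExH W f i = S.curv (W.hyperbolic.angle (uOf W f)) i := by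
  have : KExH W f i = S.curv (thetaExH W f) i := rfl
  rw [this]
  exact S.curv_congr (fun a b c hab hac hbc hF =>
    thetaExH_eq_angle W f (W.compatible _ rfl rfl a b c hab hac hbc hF)) i

end TriSurface

/-- uniqueness for the extended modified combinatorial `α`-Ricci flow.
Let `α R̄_i ≤ 0` for all `i`.  In the Euclidean background, any two `C¹` solutions of
`du_i/dt = R̄_i − R̃_{α,i}(u)` on `[0,T)` with the same initial value coincide.  In the
hyperbolic background, any two `C¹` solutions of the extended flow in the `u`-coordinates
(represented by paths of conformal factors `f(t)`, whose associated `u(t) = uOf (f(t))`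
take values in `ℝ^{N₀} × (−∞,0)^{N₁}`) with the same initial value coincide. -/
theorem extended_ricci_flow_uniqueness {N : ℕ} (S : TriSurface N)
    (W : TriSurface.Weights S) (α : ℝ) (Rbar : Fin N → ℝ)
    (hαR : ∀ i, α * Rbar i ≤ 0) (T : ℝ) :
    (∀ uA uB : ℝ → Fin N → ℝ,
      (∀ t ∈ Set.Ico (0 : ℝ) T, ∀ i, HasDerivWithinAt (fun s => uA s i)
        (Rbar i - RExE W α (uA t) i) (Set.Ico (0 : ℝ) T) t) →
      (∀ t ∈ Set.Ico (0 : ℝ) T, ∀ i, HasDerivWithinAt (fun s => uB s i)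
        (Rbar i - RExE W α (uB t) i) (Set.Ico (0 : ℝ) T) t) →
      uA 0 = uB 0 → ∀ t ∈ Set.Ico (0 : ℝ) T, uA t = uB t) ∧
    (∀ fA fB : ℝ → Fin N → ℝ,
      (∀ t ∈ Set.Ico (0 : ℝ) T, ∀ i, HasDerivWithinAt (fun s => uOf W (fA s) i)
        (Rbar i - RExH W α (fA t) i) (Set.Ico (0 : ℝ) T) t) →
      (∀ t ∈ Set.Ico (0 : ℝ) T, ∀ i, HasDerivWithinAt (fun s => uOf W (fB s) i)
        (Rbar i - RExH W α (fB t) i) (Set.Ico (0 : ℝ) T) t) →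
      fA 0 = fB 0 → ∀ t ∈ Set.Ico (0 : ℝ) T, fA t = fB t) := by
  refine ⟨fun uA uB hA hB h0 => ?_, fun fA fB hA hB h0 t ht => uOf_injective W ?_⟩
  · simp only [RExE, KExE_eq_curv] at hA hB
    exact (W.compatible W.euclidean rfl rfl).flow_unique (fun _ _ => Set.mem_univ _)
      (fun _ _ => Set.mem_univ _) hA hB h0
  · simp only [RExH, KExH_eq_curv] at hA hB
    exact (W.compatible W.hyperbolic rfl rfl).flow_unique (uA := fun t => uOf W (fA t))
      (uB := fun t => uOf W (fB t)) (fun t => uOf_mem_Dom W (fA t))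
      (fun t => uOf_mem_Dom W (fB t)) hA hB (congrArg (uOf W) h0) t ht
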